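/- arXiv:2409.17078 — 2 statements merged into one kernel-verified Lean document; each statement's English description precedes it below -/
import Mathlib

section
/- Let R, B ⊂ ℝ² be finite disjoint sets with |R| = n, |B| = m, m ≥ n ≥ 2, and R ∪ B in general position. Then the number of empty red-red-blue triangles in R ∪ B is at least c·n^{3/2} for an absolute constant c > 0 (one may take c = 1/72 for n large enough). -/
/-- No three distinct points of `S` are collinear. -/
def GenPos (S : Set ℂ) : Prop :=
  ∀ p ∈ S, ∀ q ∈ S, ∀ r ∈ S, p ≠ q → p ≠ r → q ≠ r → ¬ Collinear ℝ ({p, q, r} : Set ℂ)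

/-- The collection of empty red-red-blue triangles. -/
def emptyRRB (R B : Finset ℂ) : Set (Set ℂ) :=
  {T | ∃ a b c : ℂ, a ∈ R ∧ b ∈ R ∧ c ∈ B ∧ a ≠ b ∧ T = {a, b, c} ∧
    convexHull ℝ {a, b, c} ∩ (↑R ∪ ↑B : Set ℂ) = ({a, b, c} : Set ℂ)}

/-- The number of adjacent pairs of entries of a list that satisfy `P`. -/
def adjCount {α : Type*} (P : α → α → Bool) : List α → ℕ
  | x :: y :: l => (if P x y then 1 else 0) + adjCount P (y :: l)
  | _ => 0

section Words

variable {α : Type*}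

theorem adjCount_le_cons (P : α → α → Bool) (x : α) (l : List α) :
    adjCount P l ≤ adjCount P (x :: l) := by
  cases l <;> simp [adjCount]

theorem adjCount_le_append (P : α → α → Bool) (u v : List α) :
    adjCount P v ≤ adjCount P (u ++ v) := by
  induction u with
  | nil => simp
  | cons x u ih => exact ih.trans (adjCount_le_cons P x (u ++ v))

theorem countP_le_adjCount_add (c : α → Bool) (l : List α) :
    l.countP c ≤ adjCount (fun x y => c x && c y) l + l.countP (fun x => !c x) + 1 := by
  suffices h : ∀ l : List α, ∀ x : α, (x :: l).countP c ≤
      adjCount (fun x y => c x && c y) (x :: l) + (x :: l).countP (fun x => !c x) +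
        if c x then 1 else 0 by
    cases l with
    | nil => simp
    | cons x l => exact (h l x).trans (by split_ifs <;> omega)
  intro l
  induction l with
  | nil => intro x; simp [List.countP_cons, adjCount]
  | cons y l ih =>
    intro x
    have := ih y
    rw [List.countP_cons, List.countP_cons (p := fun x => !c x), adjCount]
    cases hx : c x <;> cases hy : c y <;> simp_all <;> omega

theorem adjCount_pos_of_mem (c : α → Bool) (l : List α) (x y : α) (hx : x ∈ l) (hy : y ∈ l)
    (hcx : c x = true) (hcy : c y = false) : 0 < adjCount (fun x y => c x != c y) l := by
  suffices h : ∀ l : List α, ∀ x, adjCount (fun x y => c x != c y) (x :: l) = 0 →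
      ∀ y ∈ x :: l, c y = c x by
    by_contra h0
    cases l with
    | nil => simp at hx
    | cons z l =>
      have := h l z (by omega)
      have h1 := this x hx
      have h2 := this y hy
      simp_all
  intro l
  induction l with
  | nil => simp
  | cons y l ih =>
    intro x h z hz
    rw [adjCount] at h
    have h1 := ih y (by omega)
    have h2 : c x = c y := by
      by_contra hne
      simp [hne] at h
    rcases List.mem_cons.1 hz with rfl | hz
    · rfl
    · rw [h1 z hz, h2]

theorem exists_balanced_prefix_of_lt (c : α → Bool) (v : List α) :
    ∀ u : List α, 2 * u.countP (fun x => !c x) < u.countP c →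
      2 * (u ++ v).countP (fun x => !c x) < (u ++ v).countP c ∨
      ∃ v₁ v₂, v = v₁ ++ v₂ ∧
        (u ++ v₁).countP c ≤ 2 * (u ++ v₁).countP (fun x => !c x) ∧
        2 * (u ++ v₁).countP (fun x => !c x) ≤ (u ++ v₁).countP c + 1 := by
  induction v with
  | nil => intro u hu; left; simpa using hu
  | cons x v ih =>
    intro u hu
    by_cases h : 2 * (u ++ [x]).countP (fun x => !c x) < (u ++ [x]).countP c
    · rcases ih _ h with h | ⟨v₁, v₂, rfl, h⟩
      · left; simpa using h
      · exact Or.inr ⟨x :: v₁, v₂, rfl, by simpa using h⟩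
    · refine Or.inr ⟨[x], v, rfl, by omega, ?_⟩
      simp only [List.countP_append, List.countP_singleton] at h ⊢
      cases c x <;> simp at h ⊢ <;> omega

theorem exists_balanced_suffix_of_lt (c : α → Bool) (u : List α) :
    ∀ v : List α, 2 * v.countP (fun x => !c x) < v.countP c →
      2 * (u ++ v).countP (fun x => !c x) < (u ++ v).countP c ∨
      ∃ u₁ u₂, u = u₁ ++ u₂ ∧
        (u₂ ++ v).countP c ≤ 2 * (u₂ ++ v).countP (fun x => !c x) ∧
        2 * (u₂ ++ v).countP (fun x => !c x) ≤ (u₂ ++ v).countP c + 1 := by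
  induction u using List.reverseRecOn with
  | nil => intro v hv; left; simpa using hv
  | append_singleton u x ih =>
    intro v hv
    by_cases h : 2 * (x :: v).countP (fun x => !c x) < (x :: v).countP c
    · rcases ih _ h with h | ⟨u₁, u₂, rfl, h⟩
      · left; simpa using h
      · exact Or.inr ⟨u₁, u₂ ++ [x], by simp, by simpa using h⟩
    · refine Or.inr ⟨u, [x], rfl, by simpa using h, ?_⟩
      simp only [List.countP_append, List.countP_cons] at h ⊢
      cases c x <;> simp at h ⊢ <;> omega

theorem sq_le_of_balanced {q k : ℕ} (hq : 6 ≤ q) (h₁ : q ≤ 2 * k) (h₂ : 2 * k ≤ q + 1) :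
    q * q ≤ 8 * (k * (q - k - 1)) := by
  obtain ⟨j, hj⟩ : ∃ j, q - k - 1 = j := ⟨_, rfl⟩
  have : q = k + j + 1 := by omega
  rw [hj]
  subst this
  have h3 : k ≤ j + 2 := by omega
  have h4 : j + 1 ≤ k := by omega
  have h5 : 2 ≤ j := by omega
  nlinarith [Nat.mul_le_mul h5 h4, Nat.mul_le_mul h3 h3, Nat.mul_le_mul h5 h5]

/-- If a function on the sublists of a two-coloured word is superadditive and dominates
`k * (q - k - 1)`, where `q` and `k` count the two colours, then it is large
unless the word changes colour often or has a suffix with a large surplus of the first colour. -/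
theorem mul_countP_le_of_superadditive (c : α → Bool) (F : List α → ℕ) (Q D : ℕ) (hQ : 6 ≤ Q) :
    ∀ (n : ℕ) (w : List α), w.length = n →
      (∀ u v, u ++ v <:+: w → F u + F v ≤ F (u ++ v)) →
      (∀ u, u <:+: w →
        u.countP (fun x => !c x) * (u.countP c - u.countP (fun x => !c x) - 1) ≤ F u) →
      (∀ v, v <:+ w → v.countP c ≤ 2 * v.countP (fun x => !c x) + D) →
      Q * w.countP c ≤
        8 * F w + Q * Q * (adjCount (fun x y => c x != c y) w + 1) + Q * D := by
  intro n
  induction n using Nat.strong_induction_on with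
  | _ n ih =>
  intro w hn hadd hF hD
  subst hn
  have step : ∀ u v, w = u ++ v → u ≠ [] →
      Q * v.countP c ≤
        8 * F v + Q * Q * (adjCount (fun x y => c x != c y) v + 1) + Q * D := by
    intro u v huv hu
    have hvw : v <:+ w := ⟨u, huv.symm⟩
    refine ih v.length ?_ v rfl ?_ ?_ ?_
    · have := List.length_pos_of_ne_nil hu
      rw [huv, List.length_append]; omega
    · intro a b hab; exact hadd a b (hab.trans hvw.isInfix)
    · intro a ha; exact hF a (ha.trans hvw.isInfix)
    · intro a ha; exact hD a (ha.trans hvw)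
  obtain ⟨r, v, hw, hr, hv⟩ : ∃ r v, w = r ++ v ∧ (∀ x ∈ r, c x = true) ∧
      (∀ y v', v = y :: v' → c y = false) := by
    refine ⟨w.takeWhile c, w.dropWhile c, List.takeWhile_append_dropWhile.symm,
      fun x hx => List.mem_takeWhile_imp hx, ?_⟩
    intro y v' h
    have := List.head?_dropWhile_not c w
    rw [h] at this
    simpa using this
  have hr1 : r.countP c = r.length := List.countP_eq_length.2 hr
  have hr2 : r.countP (fun x => !c x) = 0 := by
    rw [List.countP_eq_zero]; intro x hx; simp [hr x hx]
  by_cases hlong : r.length < Q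
  · cases v with
    | nil =>
      subst hw
      simp only [List.append_nil, hr1]
      nlinarith [Nat.zero_le (Q * Q * adjCount (fun x y => c x != c y) r), Nat.zero_le (Q * D)]
    | cons y v =>
      have hy := hv y v rfl
      by_cases hnil : r = []
      · subst hnil
        have := step [y] v (by simpa using hw) (by simp)
        have h2 := hadd [y] v (by rw [hw]; exact List.infix_rfl)
        have h3 := adjCount_le_cons (fun x y => c x != c y) y v
        rw [hw]
        simp only [List.nil_append, List.countP_cons, hy]
        have h4 := Nat.mul_le_mul_left (Q * Q) (Nat.add_le_add_right h3 1)
        have : [y] ++ v = y :: v := rfl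
        rw [this] at h2
        simp only [Bool.false_eq_true, if_false, add_zero]
        omega
      · have h1 := step r (y :: v) hw hnil
        have h2 := hadd r (y :: v) (by rw [hw])
        have h3 : adjCount (fun x y => c x != c y) (y :: v) + 1 ≤
            adjCount (fun x y => c x != c y) (r ++ y :: v) := by
          obtain ⟨r', x, rfl⟩ : ∃ r' x, r = r' ++ [x] :=
            ⟨_, _, (List.dropLast_append_getLast hnil).symm⟩
          have := adjCount_le_append (fun x y => c x != c y) r' (x :: y :: v)
          have hx := hr x (by simp)
          rw [adjCount] at this
          simp only [hx, hy] at this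
          simp at this ⊢
          omega
        rw [hw, List.countP_append, hr1]
        nlinarith [Nat.mul_le_mul_left (Q * Q) h3, Nat.mul_le_mul_left Q hlong.le]
  · push Not at hlong
    have hrne : r ≠ [] := by rintro rfl; simp at hlong; omega
    rcases exists_balanced_prefix_of_lt c v r (by omega) with h | ⟨v₁, v₂, rfl, h₁, h₂⟩
    · rw [← hw] at h
      have h1 := hF w List.infix_rfl
      have h2 := hD w List.suffix_rfl
      have h3 : Q ≤ w.countP c := by rw [hw, List.countP_append]; omega
      generalize w.countP c = q at *
      generalize w.countP (fun x => !c x) = k at *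
      have h4 : Q ≤ 4 * (q - k - 1) := by omega
      have h5 := Nat.mul_le_mul_left (2 * k) h4
      have h6 := Nat.mul_le_mul_left Q h2
      nlinarith [Nat.zero_le (Q * Q * (adjCount (fun x y => c x != c y) w + 1))]
    · rw [← List.append_assoc] at hw
      have h3 := step (r ++ v₁) v₂ hw (by simp [hrne])
      have h4 := hadd (r ++ v₁) v₂ (by rw [hw])
      have h5 := hF (r ++ v₁) (by rw [hw]; exact (List.prefix_append _ _).isInfix)
      have h6 : Q ≤ (r ++ v₁).countP c := by rw [List.countP_append]; omega
      have h7 := adjCount_le_append (fun x y => c x != c y) (r ++ v₁) v₂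
      have h8 := sq_le_of_balanced (hQ.trans h6) h₁ h₂
      have h9 := Nat.mul_le_mul_right ((r ++ v₁).countP c) h6
      have h10 := Nat.mul_le_mul_left (Q * Q) (Nat.add_le_add_right h7 1)
      rw [hw, List.countP_append]
      nlinarith

theorem countP_dichotomy (c : α → Bool) (F : List α → ℕ) (Q D : ℕ) (hQ : 6 ≤ Q) (hD : 6 ≤ D)
    (w : List α) (hadd : ∀ u v, u ++ v <:+: w → F u + F v ≤ F (u ++ v))
    (hF : ∀ u, u <:+: w →
      u.countP (fun x => !c x) * (u.countP c - u.countP (fun x => !c x) - 1) ≤ F u)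
    (hw : w.countP c ≤ 2 * w.countP (fun x => !c x)) :
    D * D ≤ 8 * F w ∨ Q * w.countP c ≤
      8 * F w + Q * Q * (adjCount (fun x y => c x != c y) w + 1) + Q * D := by
  by_cases hsuf : ∀ v, v <:+ w → v.countP c ≤ 2 * v.countP (fun x => !c x) + D
  · exact Or.inr (mul_countP_le_of_superadditive c F Q D hQ _ w rfl hadd hF hsuf)
  · left
    push Not at hsuf
    obtain ⟨v, ⟨u, rfl⟩, hv⟩ := hsuf
    rcases exists_balanced_suffix_of_lt c u v (by omega) with h | ⟨u₁, u₂, rfl, h₁, h₂⟩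
    · omega
    · have hq : D ≤ (u₂ ++ v).countP c := by rw [List.countP_append]; omega
      rw [List.append_assoc] at hadd hF ⊢
      have h3 := hF (u₂ ++ v) (List.suffix_append _ _).isInfix
      have h4 := hadd u₁ (u₂ ++ v) List.infix_rfl
      have h5 := sq_le_of_balanced (hD.trans hq) h₁ h₂
      have h6 := Nat.mul_le_mul hq hq
      omega

end Words

section Geometry

/-- Twice the signed area of the triangle `p a b`. -/
def cross (p a b : ℂ) : ℝ :=
  (a.re - p.re) * (b.im - p.im) - (a.im - p.im) * (b.re - p.re)

/-- The real inner product with `u`. -/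
def linForm (u z : ℂ) : ℝ := u.re * z.re + u.im * z.im

theorem mem_convexHull_triple {s a b c : ℂ} (h : s ∈ convexHull ℝ ({a, b, c} : Set ℂ)) :
    ∃ x y z : ℝ, 0 ≤ x ∧ 0 ≤ y ∧ 0 ≤ z ∧ x + y + z = 1 ∧ s = x • a + y • b + z • c := by
  rw [convexHull_insert (by simp), mem_convexJoin] at h
  simp only [convexHull_pair, Set.mem_singleton_iff, exists_eq_left] at h
  obtain ⟨d, ⟨y, z, hy, hz, hyz, rfl⟩, ⟨x, w, hx, hw, hxw, rfl⟩⟩ := h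
  exact ⟨x, w * y, w * z, hx, by positivity, by positivity,
    by rw [add_assoc, ← mul_add, hyz]; linarith, by module⟩

theorem cross_combo {x y z : ℝ} (h : x + y + z = 1) (p q a b c : ℂ) :
    cross p q (x • a + y • b + z • c) = x * cross p q a + y * cross p q b + z * cross p q c := by
  obtain rfl : x = 1 - y - z := by linarith
  simp only [cross, Complex.add_re, Complex.add_im, Complex.smul_re, Complex.smul_im, smul_eq_mul]
  ring

theorem linForm_combo (x y z : ℝ) (u a b c : ℂ) :
    linForm u (x • a + y • b + z • c) =
      x * linForm u a + y * linForm u b + z * linForm u c := by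
  simp only [linForm, Complex.add_re, Complex.add_im, Complex.smul_re, Complex.smul_im,
    smul_eq_mul]
  ring

@[simp] theorem cross_self_right (p a : ℂ) : cross p a a = 0 := by
  rw [cross]; ring

@[simp] theorem cross_pivot_right (p a : ℂ) : cross p a p = 0 := by
  rw [cross]; ring

theorem cross_swap (p a b : ℂ) : cross p a b = -cross p b a := by
  rw [cross, cross]; ring

theorem linForm_neg (u z : ℂ) : linForm (-u) z = -linForm u z := by
  simp only [linForm, Complex.neg_re, Complex.neg_im]; ring

theorem collinear_of_cross_eq_zero {p a b : ℂ} (hpa : p ≠ a) (h : cross p a b = 0) :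
    Collinear ℝ ({p, a, b} : Set ℂ) := by
  rw [collinear_iff_of_mem (p₀ := p) (by simp)]
  refine ⟨a - p, ?_⟩
  have hn : 0 < Complex.normSq (a - p) := Complex.normSq_pos.2 (sub_ne_zero.2 hpa.symm)
  rw [Complex.normSq_apply, Complex.sub_re, Complex.sub_im] at hn
  simp only [Set.mem_insert_iff, Set.mem_singleton_iff, forall_eq_or_imp, forall_eq, vadd_eq_add]
  refine ⟨⟨0, by simp⟩, ⟨1, by simp⟩,
    ((b.re - p.re) * (a.re - p.re) + (b.im - p.im) * (a.im - p.im)) /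
      ((a.re - p.re) * (a.re - p.re) + (a.im - p.im) * (a.im - p.im)), ?_⟩
  rw [cross] at h
  apply Complex.ext
  · simp only [Complex.add_re, Complex.smul_re, Complex.sub_re, smul_eq_mul]
    rw [div_mul_eq_mul_div, ← sub_eq_iff_eq_add, eq_div_iff hn.ne']
    linear_combination -(a.im - p.im) * h
  · simp only [Complex.add_im, Complex.smul_im, Complex.sub_im, smul_eq_mul]
    rw [div_mul_eq_mul_div, ← sub_eq_iff_eq_add, eq_div_iff hn.ne']
    linear_combination (a.re - p.re) * h

theorem GenPos.cross_ne_zero {S : Set ℂ} (hS : GenPos S) {p a b : ℂ} (hp : p ∈ S) (ha : a ∈ S)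
    (hb : b ∈ S) (hpa : p ≠ a) (hpb : p ≠ b) (hab : a ≠ b) : cross p a b ≠ 0 := fun h =>
  hS p hp a ha b hb hpa hpb hab (collinear_of_cross_eq_zero hpa h)

theorem exists_list_pairwise_lt {α : Type*} [DecidableEq α] (A : Finset α) (key : α → ℝ)
    (hkey : Set.InjOn key A) :
    ∃ l : List α, l.Nodup ∧ (∀ x, x ∈ l ↔ x ∈ A) ∧ l.Pairwise (fun x y => key x < key y) := by
  classical
  let r : α → α → Prop := fun x y => key x ≤ key y
  have : Std.Total r := ⟨fun x y => le_total _ _⟩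
  have : IsTrans α r := ⟨fun x y z => le_trans⟩
  have hp := List.perm_insertionSort r A.toList
  have hnd : (A.toList.insertionSort r).Nodup := hp.nodup_iff.2 A.nodup_toList
  have hmem : ∀ x, x ∈ A.toList.insertionSort r ↔ x ∈ A := fun x => by
    rw [hp.mem_iff, Finset.mem_toList]
  refine ⟨_, hnd, hmem, ?_⟩
  refine ((List.pairwise_insertionSort r A.toList).and hnd).imp_of_mem ?_
  intro x y hx hy h
  exact lt_of_le_of_ne h.1 fun he => h.2 (hkey ((hmem x).1 hx) ((hmem y).1 hy) he)

theorem exists_list_pairwise_cross {S : Set ℂ} (hS : GenPos S) {u p : ℂ} (hu : u ≠ 0) (hp : p ∈ S)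
    (A : Finset ℂ) (hA : ∀ x ∈ A, x ∈ S) (hpA : ∀ x ∈ A, linForm u p < linForm u x) :
    ∃ l : List ℂ, l.Nodup ∧ (∀ x, x ∈ l ↔ x ∈ A) ∧ l.Pairwise (fun x y => 0 < cross p x y) := by
  classical
  let key : ℂ → ℝ := fun x =>
    (u.re * (x.im - p.im) - u.im * (x.re - p.re)) / (linForm u x - linForm u p)
  have hn : 0 < u.re * u.re + u.im * u.im := by
    have := Complex.normSq_pos.2 hu
    rwa [Complex.normSq_apply] at this
  have hsub : ∀ x ∈ A, ∀ y ∈ A, key y - key x = (u.re * u.re + u.im * u.im) * cross p x y /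
      ((linForm u x - linForm u p) * (linForm u y - linForm u p)) := by
    intro x hx y hy
    have h1 := sub_pos.2 (hpA x hx)
    have h2 := sub_pos.2 (hpA y hy)
    simp only [key]
    rw [div_sub_div _ _ h2.ne' h1.ne']
    congr 1
    · simp only [linForm, cross]
      ring
    · ring
  have hinj : Set.InjOn key A := by
    intro x hx y hy hxy
    by_contra hne
    have h1 := sub_pos.2 (hpA x hx)
    have h2 := sub_pos.2 (hpA y hy)
    have h := hsub x hx y hy
    rw [hxy, sub_self, eq_comm, div_eq_zero_iff] at h
    have hc := hS.cross_ne_zero hp (hA x hx) (hA y hy)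
      (by rintro rfl; simp at h1) (by rintro rfl; simp at h2) hne
    rcases h with h | h
    · exact mul_ne_zero hn.ne' hc h
    · exact (mul_pos h1 h2).ne' h
  obtain ⟨l, hnd, hmem, hl⟩ := exists_list_pairwise_lt A key hinj
  refine ⟨l, hnd, hmem, hl.imp_of_mem ?_⟩
  intro x y hx hy hlt
  have h := hsub x ((hmem x).1 hx) y ((hmem y).1 hy)
  have h1 := sub_pos.2 (hpA x ((hmem x).1 hx))
  have h2 := sub_pos.2 (hpA y ((hmem y).1 hy))
  have h3 := sub_pos.2 hlt
  rw [h, div_pos_iff_of_pos_right (mul_pos h1 h2)] at h3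
  exact pos_of_mul_pos_right h3 hn.le

theorem exists_linForm_injOn (S : Finset ℂ) : ∃ u : ℂ, u ≠ 0 ∧ Set.InjOn (linForm u) S := by
  classical
  obtain ⟨t, ht⟩ := Infinite.exists_notMem_finset
    ((S ×ˢ S).image fun q => (q.1.re - q.2.re) / (q.2.im - q.1.im))
  refine ⟨⟨1, t⟩, fun h => by simpa using congrArg Complex.re h, ?_⟩
  intro x hx y hy hxy
  simp only [linForm, one_mul] at hxy
  by_cases him : y.im = x.im
  · apply Complex.ext
    · rw [him] at hxy; linarith
    · exact him.symm
  · exfalso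
    apply ht
    rw [Finset.mem_image]
    refine ⟨(x, y), Finset.mem_product.2 ⟨hx, hy⟩, ?_⟩
    have := sub_ne_zero.2 him
    field_simp
    linarith

/-- The points of `S` in a triangle spanned by points of `C` belong to `C`. -/
def TriClosed (S C : Finset ℂ) : Prop :=
  ∀ a ∈ C, ∀ b ∈ C, ∀ c ∈ C, ∀ s ∈ S, s ∈ convexHull ℝ ({a, b, c} : Set ℂ) → s ∈ C

theorem TriClosed.eq_of_mem_convexHull {S C : Finset ℂ} (hC : TriClosed S C) {u p : ℂ} (hp : p ∈ C)
    {l : List ℂ} (hl : l.Pairwise fun x y => 0 < cross p x y)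
    (hmem : ∀ x, x ∈ l ↔ x ∈ C ∧ linForm u p < linForm u x) {x y : ℂ} (hxy : [x, y] <:+: l)
    {s : ℂ} (hs : s ∈ S) (hsT : s ∈ convexHull ℝ ({p, x, y} : Set ℂ)) :
    s = p ∨ s = x ∨ s = y := by
  have hx := (hmem x).1 (hxy.subset (by simp))
  have hy := (hmem y).1 (hxy.subset (by simp))
  have hsC := hC p hp x hx.1 y hy.1 s hs hsT
  obtain ⟨α, β, γ, hα, hβ, hγ, hsum, rfl⟩ := mem_convexHull_triple hsT
  rcases eq_or_lt_of_le (add_nonneg hβ hγ) with h0 | h0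
  · left
    obtain rfl : β = 0 := by linarith
    obtain rfl : γ = 0 := by linarith
    obtain rfl : α = 1 := by linarith
    simp
  right
  have key : ∀ a b : ℝ, 0 < a → 0 < b → 0 < β * a + γ * b := by
    intro a b ha hb
    rcases eq_or_lt_of_le hβ with h | h
    · have : 0 < γ := by linarith
      rw [← h]; simp; positivity
    · positivity
  have hlin : linForm u p < linForm u (α • p + β • x + γ • y) := by
    have := key _ _ (sub_pos.2 hx.2) (sub_pos.2 hy.2)
    rw [linForm_combo]
    obtain rfl : α = 1 - β - γ := by linarith
    linarith
  set s := α • p + β • x + γ • y with hsdef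
  have hcross : cross p s s = α * cross p s p + β * cross p s x + γ * cross p s y := by
    conv_lhs => rw [hsdef, cross_combo hsum, ← hsdef]
  rw [cross_self_right, cross_pivot_right, mul_zero, zero_add] at hcross
  obtain ⟨l₁, l₂, rfl⟩ := hxy
  have hsl := (hmem s).2 ⟨hsC, hlin⟩
  rw [List.pairwise_append, List.pairwise_append] at hl
  obtain ⟨⟨-, -, h1⟩, -, h2⟩ := hl
  rw [List.mem_append, List.mem_append] at hsl
  rcases hsl with (h | h) | h
  · have := key _ _ (h1 s h x (by simp)) (h1 s h y (by simp))
    linarith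
  · simpa using h
  · have := key _ _ (h2 x (by simp) s h) (h2 y (by simp) s h)
    rw [cross_swap p s x, cross_swap p s y] at hcross
    linarith

theorem triClosed_toFinset {S : Finset ℂ} {u p : ℂ} {l : List ℂ}
    (hl : l.Pairwise fun x y => 0 < cross p x y)
    (hmem : ∀ x, x ∈ l ↔ x ∈ S ∧ linForm u p < linForm u x) {w : List ℂ} (hw : w <:+: l) :
    TriClosed S w.toFinset := by
  intro a ha b hb c hc s hs hsT
  rw [List.mem_toFinset] at ha hb hc ⊢
  obtain ⟨α, β, γ, hα, hβ, hγ, hsum, rfl⟩ := mem_convexHull_triple hsT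
  have key : ∀ a b c : ℝ, 0 < a → 0 < b → 0 < c → 0 < α * a + β * b + γ * c := by
    intro a b c ha hb hc
    rcases eq_or_lt_of_le hα with h | h
    · rcases eq_or_lt_of_le hβ with h' | h'
      · have : 0 < γ := by linarith
        rw [← h, ← h']; simp; positivity
      · positivity
    · positivity
  have hlin : linForm u p < linForm u (α • a + β • b + γ • c) := by
    have := key _ _ _ (sub_pos.2 ((hmem a).1 (hw.subset ha)).2)
      (sub_pos.2 ((hmem b).1 (hw.subset hb)).2) (sub_pos.2 ((hmem c).1 (hw.subset hc)).2)
    rw [linForm_combo]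
    obtain rfl : α = 1 - β - γ := by linarith
    linarith
  set s := α • a + β • b + γ • c with hsdef
  have hcross : cross p s s = α * cross p s a + β * cross p s b + γ * cross p s c := by
    conv_lhs => rw [hsdef, cross_combo hsum, ← hsdef]
  rw [cross_self_right] at hcross
  have hsl := (hmem s).2 ⟨hs, hlin⟩
  obtain ⟨l₁, l₂, rfl⟩ := hw
  rw [List.pairwise_append, List.pairwise_append] at hl
  obtain ⟨⟨-, -, h1⟩, -, h2⟩ := hl
  rw [List.mem_append, List.mem_append] at hsl
  rcases hsl with (h | h) | h
  · have := key _ _ _ (h1 s h a ha) (h1 s h b hb) (h1 s h c hc)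
    linarith
  · exact h
  · have := key _ _ _ (h2 a (by simp [ha]) s h) (h2 b (by simp [hb]) s h) (h2 c (by simp [hc]) s h)
    rw [cross_swap p s a, cross_swap p s b, cross_swap p s c] at hcross
    linarith

end Geometry

section Counting

open scoped Classical

/-- The empty red-red-blue triangles, as finite sets of points. -/
noncomputable def rrbFinset (R B : Finset ℂ) : Finset (Finset ℂ) :=
  (R ∪ B).powerset.filter fun T => (T : Set ℂ) ∈ emptyRRB R B

theorem card_rrbFinset_le (R B : Finset ℂ) : (rrbFinset R B).card ≤ (emptyRRB R B).ncard := by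
  have hfin : (emptyRRB R B).Finite := by
    refine (((R ∪ B).finite_toSet).finite_subsets).subset ?_
    rintro T ⟨a, b, c, ha, hb, hc, -, rfl, -⟩
    simp only [Set.mem_ofPred_eq, Finset.coe_union, Set.insert_subset_iff, Set.singleton_subset_iff]
    exact ⟨Or.inl ha, Or.inl hb, Or.inr hc⟩
  have hinj : Function.Injective (fun T : Finset ℂ => (T : Set ℂ)) := Finset.coe_injective
  rw [← Finset.card_image_of_injective (rrbFinset R B) hinj, ← Set.ncard_coe_finset]
  refine Set.ncard_le_ncard ?_ hfin
  intro T hT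
  simp only [Finset.coe_image, Set.mem_image, rrbFinset, Finset.coe_filter] at hT
  obtain ⟨T', hT', rfl⟩ := hT
  exact hT'.2

theorem exists_eq_of_mem_rrbFinset {R B T : Finset ℂ} (hT : T ∈ rrbFinset R B) :
    ∃ a b c : ℂ, a ∈ R ∧ b ∈ R ∧ c ∈ B ∧ a ≠ b ∧ T = {a, b, c} := by
  obtain ⟨-, a, b, c, ha, hb, hc, hab, hT, -⟩ := Finset.mem_filter.1 hT
  exact ⟨a, b, c, ha, hb, hc, hab, Finset.coe_injective (by push_cast; exact hT)⟩

theorem mem_rrbFinset {R B : Finset ℂ} {p x y : ℂ}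
    (hcol : ∃ a b c : ℂ, a ∈ R ∧ b ∈ R ∧ c ∈ B ∧ a ≠ b ∧ ({p, x, y} : Finset ℂ) = {a, b, c})
    (hempty : ∀ s ∈ R ∪ B, s ∈ convexHull ℝ ({p, x, y} : Set ℂ) → s = p ∨ s = x ∨ s = y) :
    ({p, x, y} : Finset ℂ) ∈ rrbFinset R B := by
  obtain ⟨a, b, c, ha, hb, hc, hab, h⟩ := hcol
  have h' : ({p, x, y} : Set ℂ) = {a, b, c} := by
    have := congrArg (fun T : Finset ℂ => (T : Set ℂ)) h
    push_cast at this
    exact this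
  have hsub : ({a, b, c} : Finset ℂ) ⊆ R ∪ B := by
    simp [Finset.insert_subset_iff, ha, hb, hc]
  refine Finset.mem_filter.2 ⟨Finset.mem_powerset.2 (h ▸ hsub), a, b, c, ha, hb, hc, hab, ?_, ?_⟩
  · simpa using h'
  · rw [← h']
    apply Set.Subset.antisymm
    · rintro s ⟨hs, hsS⟩
      simpa using hempty s (by simpa using hsS) hs
    · intro s hs
      refine ⟨subset_convexHull ℝ _ hs, ?_⟩
      rw [h'] at hs
      have := hsub (by simpa using hs : s ∈ ({a, b, c} : Finset ℂ))
      simpa using this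

theorem adjCount_le_card_fan (E : Finset (Finset ℂ)) (P : ℂ → ℂ → Bool) (p : ℂ) (l : List ℂ)
    (hnd : l.Nodup) (hp : p ∉ l)
    (hE : ∀ x y, [x, y] <:+: l → P x y = true → ({p, x, y} : Finset ℂ) ∈ E) :
    adjCount P l ≤ (E.filter fun T => p ∈ T ∧ T ⊆ insert p l.toFinset).card := by
  induction l with
  | nil => simp [adjCount]
  | cons x l ih =>
    cases l with
    | nil => simp [adjCount]
    | cons y l =>
      have ih' := ih hnd.of_cons (fun h => hp (List.mem_cons_of_mem _ h))
        (fun a b hab => hE a b (hab.trans (List.suffix_cons _ _).isInfix))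
      have hsub : (E.filter fun T => p ∈ T ∧ T ⊆ insert p (y :: l).toFinset) ⊆
          E.filter fun T => p ∈ T ∧ T ⊆ insert p (x :: y :: l).toFinset := by
        refine Finset.monotone_filter_right _ ?_
        rintro T - ⟨h1, h2⟩
        refine ⟨h1, h2.trans (Finset.insert_subset_insert _ ?_)⟩
        rw [List.toFinset_cons (a := x)]
        exact Finset.subset_insert _ _
      rw [adjCount]
      by_cases hP : P x y = true
      · rw [if_pos hP]
        have hmem := hE x y ⟨[], l, by simp⟩ hP
        have hnot : ({p, x, y} : Finset ℂ) ∉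
            E.filter fun T => p ∈ T ∧ T ⊆ insert p (y :: l).toFinset := by
          intro h
          have h1 := (Finset.mem_filter.1 h).2.2 (by simp : x ∈ ({p, x, y} : Finset ℂ))
          rw [Finset.mem_insert, List.mem_toFinset] at h1
          rcases h1 with rfl | h1
          · exact hp (by simp)
          · exact (List.nodup_cons.1 hnd).1 h1
        have := Finset.card_le_card (Finset.insert_subset (Finset.mem_filter.2
          ⟨hmem, by simp, by
            intro z hz
            simp only [Finset.mem_insert, Finset.mem_singleton] at hz
            simp only [Finset.mem_insert, List.mem_toFinset, List.mem_cons]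
            tauto⟩) hsub)
        rw [Finset.card_insert_of_notMem hnot] at this
        omega
      · rw [if_neg hP, zero_add]
        exact ih'.trans (Finset.card_le_card hsub)

theorem card_filter_lt_add_card_filter_gt {u p : ℂ} {S X : Finset ℂ}
    (hu : Set.InjOn (linForm u) S) (hX : X ⊆ S) (hp : p ∈ S) :
    (X.filter fun x => linForm u p < linForm u x).card +
      (X.filter fun x => linForm u x < linForm u p).card + (if p ∈ X then 1 else 0) = X.card := by
  have h1 : (if p ∈ X then 1 else 0) = (X.filter fun x => x = p).card := by
    rw [Finset.filter_eq' X p]; split_ifs <;> simp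
  rw [h1, ← Finset.card_union_of_disjoint, ← Finset.card_union_of_disjoint]
  · congr 1
    ext x
    simp only [Finset.mem_union, Finset.mem_filter]
    constructor
    · tauto
    · intro hx
      rcases lt_trichotomy (linForm u p) (linForm u x) with h | h | h
      · exact Or.inl (Or.inl ⟨hx, h⟩)
      · exact Or.inr ⟨hx, (hu hp (hX hx) h).symm⟩
      · exact Or.inl (Or.inr ⟨hx, h⟩)
  · rw [Finset.disjoint_left]
    intro x hx hx'
    simp only [Finset.mem_union, Finset.mem_filter] at hx hx'
    obtain ⟨-, rfl⟩ := hx'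
    simp at hx
  · rw [Finset.disjoint_left]
    intro x hx hx'
    exact lt_asymm (Finset.mem_filter.1 hx).2 (Finset.mem_filter.1 hx').2

theorem countP_eq_card_filter {α : Type*} {l : List α} (hl : l.Nodup) (A : Finset α)
    (hA : ∀ x, x ∈ l ↔ x ∈ A) (c : α → Bool) :
    l.countP c = (A.filter fun x => c x = true).card := by
  have : A.filter (fun x => c x = true) = (l.filter c).toFinset := by
    ext x; simp [hA]
  rw [this, List.toFinset_card_of_nodup (hl.filter c), List.countP_eq_length_filter]

theorem exists_fan {R B C : Finset ℂ} (hS : GenPos (↑R ∪ ↑B)) {u p : ℂ} (hu : u ≠ 0)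
    (hC : C ⊆ R ∪ B) (hcl : TriClosed (R ∪ B) C) (hp : p ∈ C) (P : ℂ → ℂ → Bool)
    (hP : ∀ x ∈ C, ∀ y ∈ C, x ≠ y → x ≠ p → y ≠ p → P x y = true →
      ∃ a b c : ℂ, a ∈ R ∧ b ∈ R ∧ c ∈ B ∧ a ≠ b ∧ ({p, x, y} : Finset ℂ) = {a, b, c}) :
    ∃ l : List ℂ, l.Nodup ∧ (∀ x, x ∈ l ↔ x ∈ C ∧ linForm u p < linForm u x) ∧
      l.Pairwise (fun x y => 0 < cross p x y) ∧
      adjCount P l ≤ ((rrbFinset R B).filter fun T => p ∈ T ∧ T ⊆ insert p l.toFinset).card := by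
  have hmemS : ∀ x ∈ C, x ∈ (↑R ∪ ↑B : Set ℂ) := fun x hx => by simpa using hC hx
  obtain ⟨l, hnd, hmem, hl⟩ := exists_list_pairwise_cross hS hu (hmemS p hp)
    (C.filter fun x => linForm u p < linForm u x)
    (fun x hx => hmemS x (Finset.mem_filter.1 hx).1) (fun x hx => (Finset.mem_filter.1 hx).2)
  simp only [Finset.mem_filter] at hmem
  have hpl : p ∉ l := fun h => lt_irrefl _ ((hmem p).1 h).2
  refine ⟨l, hnd, hmem, hl, adjCount_le_card_fan _ P p l hnd hpl ?_⟩
  intro x y hxy hPxy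
  have hx : x ∈ l := hxy.subset (by simp)
  have hy : y ∈ l := hxy.subset (by simp)
  have hne : x ≠ y := by
    have := hxy.sublist.nodup hnd
    simpa using this
  exact mem_rrbFinset (hP x ((hmem x).1 hx).1 y ((hmem y).1 hy).1 hne
    (fun h => hpl (h ▸ hx)) (fun h => hpl (h ▸ hy)) hPxy)
    fun s hs hsT => hcl.eq_of_mem_convexHull hp hl hmem hxy hs hsT

theorem card_eq_three_of_mem_rrbFinset {R B T : Finset ℂ} (hRB : Disjoint R B)
    (hT : T ∈ rrbFinset R B) : T.card = 3 := by
  obtain ⟨a, b, c, ha, hb, hc, hab, rfl⟩ := exists_eq_of_mem_rrbFinset hT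
  rw [Finset.disjoint_left] at hRB
  exact Finset.card_eq_three.2 ⟨a, b, c, hab, fun h => hRB ha (h ▸ hc), fun h => hRB hb (h ▸ hc), rfl⟩

theorem exists_double_fan {R B C : Finset ℂ} (hRB : Disjoint R B) (hS : GenPos (↑R ∪ ↑B))
    {u p : ℂ} (hu : u ≠ 0)
    (hC : C ⊆ R ∪ B) (hcl : TriClosed (R ∪ B) C) (hp : p ∈ C) (P : ℂ → ℂ → Bool)
    (hP : ∀ x ∈ C, ∀ y ∈ C, x ≠ y → x ≠ p → y ≠ p → P x y = true →
      ∃ a b c : ℂ, a ∈ R ∧ b ∈ R ∧ c ∈ B ∧ a ≠ b ∧ ({p, x, y} : Finset ℂ) = {a, b, c}) :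
    ∃ l₁ l₂ : List ℂ, l₁.Nodup ∧ l₂.Nodup ∧
      (∀ x, x ∈ l₁ ↔ x ∈ C ∧ linForm u p < linForm u x) ∧
      (∀ x, x ∈ l₂ ↔ x ∈ C ∧ linForm u x < linForm u p) ∧
      l₁.Pairwise (fun x y => 0 < cross p x y) ∧ l₂.Pairwise (fun x y => 0 < cross p x y) ∧
      adjCount P l₁ + adjCount P l₂ ≤
        ((rrbFinset R B).filter fun T => p ∈ T ∧ T ⊆ C).card := by
  obtain ⟨l₁, hnd₁, hm₁, hl₁, h₁⟩ := exists_fan hS hu hC hcl hp P hP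
  obtain ⟨l₂, hnd₂, hm₂, hl₂, h₂⟩ := exists_fan hS (neg_ne_zero.2 hu) hC hcl hp P hP
  simp only [linForm_neg, neg_lt_neg_iff] at hm₂
  refine ⟨l₁, l₂, hnd₁, hnd₂, hm₁, hm₂, hl₁, hl₂, (Nat.add_le_add h₁ h₂).trans ?_⟩
  rw [← Finset.card_union_of_disjoint]
  · refine Finset.card_le_card (Finset.union_subset ?_ ?_)
    · refine Finset.monotone_filter_right _ ?_
      rintro T - ⟨h, h'⟩
      refine ⟨h, h'.trans (Finset.insert_subset hp fun x hx => ?_)⟩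
      exact ((hm₁ x).1 (List.mem_toFinset.1 hx)).1
    · refine Finset.monotone_filter_right _ ?_
      rintro T - ⟨h, h'⟩
      refine ⟨h, h'.trans (Finset.insert_subset hp fun x hx => ?_)⟩
      exact ((hm₂ x).1 (List.mem_toFinset.1 hx)).1
  · rw [Finset.disjoint_left]
    intro T hT hT'
    rw [Finset.mem_filter] at hT hT'
    have hsub : T ⊆ {p} := by
      intro x hx
      have h1 := hT.2.2 hx
      have h2 := hT'.2.2 hx
      rw [Finset.mem_insert, List.mem_toFinset] at h1 h2
      rw [Finset.mem_singleton]
      rcases h1 with h1 | h1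
      · exact h1
      rcases h2 with h2 | h2
      · exact h2
      exact absurd ((hm₁ x).1 h1).2 (lt_asymm ((hm₂ x).1 h2).2)
    have h3 := Finset.card_le_card hsub
    rw [card_eq_three_of_mem_rrbFinset hRB hT.1] at h3
    simp at h3

theorem sum_card_filter_mem_le {α : Type*} (E : Finset (Finset α)) (X : Finset α)
    (κ : ℕ) (h : ∀ T ∈ E, (X.filter fun x => x ∈ T).card ≤ κ) :
    ∑ x ∈ X, (E.filter fun T => x ∈ T).card ≤ κ * E.card := by
  have := Finset.sum_card_bipartiteAbove_eq_sum_card_bipartiteBelow (s := X) (t := E)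
    (fun x T => x ∈ T)
  simp only [Finset.bipartiteAbove, Finset.bipartiteBelow] at this
  rw [this, mul_comm, ← smul_eq_mul]
  exact Finset.sum_le_card_nsmul _ _ _ h

/-- A convexly closed set with `q` red and `k` blue points spans at least `k * (q - k - 1)`
empty red-red-blue triangles. -/
theorem card_mul_le_card_rrb {R B C : Finset ℂ} (hRB : Disjoint R B) (hS : GenPos (↑R ∪ ↑B))
    (hC : C ⊆ R ∪ B) (hcl : TriClosed (R ∪ B) C) :
    (C.filter fun x => x ∉ R).card *
        ((C.filter fun x => x ∈ R).card - (C.filter fun x => x ∉ R).card - 1) ≤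
      ((rrbFinset R B).filter fun T => T ⊆ C).card := by
  obtain ⟨u, hu, hinj⟩ := exists_linForm_injOn (R ∪ B)
  have hdis := Finset.disjoint_left.1 hRB
  have hone : ∀ T ∈ (rrbFinset R B).filter (fun T => T ⊆ C),
      ((C.filter fun x => x ∉ R).filter fun x => x ∈ T).card ≤ 1 := by
    intro T hT
    obtain ⟨a, b, c, ha, hb, hc, hab, rfl⟩ := exists_eq_of_mem_rrbFinset (Finset.mem_filter.1 hT).1
    refine Finset.card_le_one_iff_subset_singleton.2 ⟨c, ?_⟩
    intro x hx
    simp only [Finset.mem_filter, Finset.mem_insert, Finset.mem_singleton] at hx ⊢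
    rcases hx.2 with rfl | rfl | rfl
    · exact absurd ha hx.1.2
    · exact absurd hb hx.1.2
    · rfl
  have hsum := sum_card_filter_mem_le _ _ 1 hone
  rw [one_mul] at hsum
  refine le_trans ?_ hsum
  rw [← smul_eq_mul]
  refine Finset.card_nsmul_le_sum _ _ _ ?_
  intro p hp
  obtain ⟨hpC, hpR⟩ := Finset.mem_filter.1 hp
  have hpB : p ∈ B := (Finset.mem_union.1 (hC hpC)).resolve_left hpR
  obtain ⟨l₁, l₂, hnd₁, hnd₂, hm₁, hm₂, -, -, hadj⟩ := exists_double_fan hRB hS hu hC hcl hpC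
    (fun x y => decide (x ∈ R) && decide (y ∈ R)) (by
      intro x _ y _ hxy _ _ h
      simp only [Bool.and_eq_true, decide_eq_true_eq] at h
      refine ⟨x, y, p, h.1, h.2, hpB, hxy, ?_⟩
      ext z; simp; tauto)
  have e₁ := countP_le_adjCount_add (fun x => decide (x ∈ R)) l₁
  have e₂ := countP_le_adjCount_add (fun x => decide (x ∈ R)) l₂
  rw [countP_eq_card_filter hnd₁ (C.filter fun x => linForm u p < linForm u x)
      (by simpa using hm₁), countP_eq_card_filter hnd₁
      (C.filter fun x => linForm u p < linForm u x) (by simpa using hm₁)] at e₁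
  rw [countP_eq_card_filter hnd₂ (C.filter fun x => linForm u x < linForm u p)
      (by simpa using hm₂), countP_eq_card_filter hnd₂
      (C.filter fun x => linForm u x < linForm u p) (by simpa using hm₂)] at e₂
  simp only [decide_eq_true_eq, Bool.not_eq_true', decide_eq_false_iff_not] at e₁ e₂
  rw [Finset.filter_comm, Finset.filter_comm (p := fun x => linForm u p < linForm u x)] at e₁
  rw [Finset.filter_comm, Finset.filter_comm (p := fun x => linForm u x < linForm u p)] at e₂
  have s₁ := card_filter_lt_add_card_filter_gt hinj
    ((Finset.filter_subset (fun x => x ∈ R) C).trans hC) (hC hpC)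
  have s₂ := card_filter_lt_add_card_filter_gt hinj
    ((Finset.filter_subset (fun x => x ∉ R) C).trans hC) (hC hpC)
  rw [if_neg (by simp [hpR])] at s₁
  rw [if_pos hp] at s₂
  have hfin : ((rrbFinset R B).filter fun T => p ∈ T ∧ T ⊆ C) =
      ((rrbFinset R B).filter fun T => T ⊆ C).filter fun T => p ∈ T := by
    rw [Finset.filter_filter]; simp only [and_comm]
  rw [hfin] at hadj
  omega

theorem rrb_dichotomy {R B : Finset ℂ} (hRB : Disjoint R B) (hS : GenPos (↑R ∪ ↑B)) {u p : ℂ}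
    {l : List ℂ} (hnd : l.Nodup) (hm : ∀ x, x ∈ l ↔ x ∈ R ∪ B ∧ linForm u p < linForm u x)
    (hl : l.Pairwise fun x y => 0 < cross p x y) {Q D : ℕ} (hQ : 6 ≤ Q) (hD : 6 ≤ D)
    (hw : l.countP (fun x => decide (x ∈ R)) ≤ 2 * l.countP (fun x => !decide (x ∈ R))) :
    D * D ≤ 8 * (rrbFinset R B).card ∨ Q * l.countP (fun x => decide (x ∈ R)) ≤
      8 * (rrbFinset R B).card +
        Q * Q * (adjCount (fun x y => decide (x ∈ R) != decide (y ∈ R)) l + 1) + Q * D := by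
  let F : List ℂ → ℕ := fun w => ((rrbFinset R B).filter fun T => T ⊆ w.toFinset).card
  have hF : F l ≤ (rrbFinset R B).card := Finset.card_filter_le _ _
  have key := countP_dichotomy (fun x => decide (x ∈ R)) F Q D hQ hD l ?_ ?_ hw
  · omega
  · intro v w hvw
    have hnd' := hvw.sublist.nodup hnd
    simp only [F]
    rw [← Finset.card_union_of_disjoint]
    · refine Finset.card_le_card (Finset.union_subset ?_ ?_)
      · refine Finset.monotone_filter_right _ fun T _ h => h.trans ?_
        rw [List.toFinset_append]; exact Finset.subset_union_left
      · refine Finset.monotone_filter_right _ fun T _ h => h.trans ?_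
        rw [List.toFinset_append]; exact Finset.subset_union_right
    · rw [Finset.disjoint_left]
      intro T hT hT'
      rw [Finset.mem_filter] at hT hT'
      have h3 := card_eq_three_of_mem_rrbFinset hRB hT.1
      obtain ⟨x, hx⟩ := Finset.card_pos.1 (by omega : 0 < T.card)
      exact (List.disjoint_of_nodup_append hnd') (List.mem_toFinset.1 (hT.2 hx))
        (List.mem_toFinset.1 (hT'.2 hx))
  · intro w hw'
    have hndw := hw'.sublist.nodup hnd
    have := card_mul_le_card_rrb hRB hS (C := w.toFinset)
      (fun x hx => ((hm x).1 (hw'.subset (List.mem_toFinset.1 hx))).1)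
      (triClosed_toFinset hl hm hw')
    rw [countP_eq_card_filter hndw w.toFinset (by simp),
      countP_eq_card_filter hndw w.toFinset (by simp)]
    simpa only [decide_eq_true_eq, Bool.not_eq_true', decide_eq_false_iff_not] using this

theorem card_filter_rank_lt_le {α : Type*} (R : Finset α) (f : α → ℝ) (hf : Set.InjOn f R)
    (k : ℕ) : (R.filter fun r => (R.filter fun x => f x < f r).card < k).card ≤ k := by
  have h := Finset.card_le_card_of_injOn (s := R.filter fun r => (R.filter fun x => f x < f r).card < k)
    (t := Finset.range k) (fun r => (R.filter fun x => f x < f r).card)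
    (fun r hr => by simpa using (Finset.mem_filter.1 hr).2) ?_
  · simpa using h
  have hlt : ∀ r ∈ R, ∀ s, f r < f s →
      (R.filter fun x => f x < f r).card < (R.filter fun x => f x < f s).card := by
    intro r hr s hrs
    refine Finset.card_lt_card (Finset.ssubset_iff_of_subset ?_ |>.2 ⟨r, by simp [hr, hrs], by simp⟩)
    exact Finset.monotone_filter_right _ fun x _ hx => lt_trans hx hrs
  intro r hr s hs hrs
  have hr' := (Finset.mem_filter.1 hr).1
  have hs' := (Finset.mem_filter.1 hs).1
  rcases lt_trichotomy (f r) (f s) with h | h | h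
  · exact absurd hrs (hlt r hr' s h).ne
  · exact hf hr' hs' h
  · exact absurd hrs (hlt s hs' r h).ne'

/-- Some red point has at least a quarter of the red points on either side and
lies in few triangles. -/
theorem exists_middle_red {R B : Finset ℂ} (hRB : Disjoint R B) (hn : 2 ≤ R.card) {u : ℂ}
    (hinj : Set.InjOn (linForm u) R) :
    ∃ r ∈ R, R.card / 4 ≤ (R.filter fun x => linForm u r < linForm u x).card ∧
      R.card / 4 ≤ (R.filter fun x => linForm u x < linForm u r).card ∧
      ((rrbFinset R B).filter fun T => r ∈ T).card * R.card ≤ 4 * (rrbFinset R B).card := by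
  set k := R.card / 4 with hk
  have h1 := card_filter_rank_lt_le R (linForm u) hinj k
  have h2 := card_filter_rank_lt_le R (fun x => -linForm u x)
    (fun x hx y hy h => hinj hx hy (neg_injective h)) k
  simp only [neg_lt_neg_iff] at h2
  set M := R.filter fun r => k ≤ (R.filter fun x => linForm u r < linForm u x).card ∧
    k ≤ (R.filter fun x => linForm u x < linForm u r).card with hM
  have hcover : R ⊆ M ∪ ((R.filter fun r => (R.filter fun x => linForm u x < linForm u r).card < k)
      ∪ (R.filter fun r => (R.filter fun x => linForm u r < linForm u x).card < k)) := by
    intro r hr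
    simp only [hM, Finset.mem_union, Finset.mem_filter, hr, true_and]
    omega
  have h3 := (Finset.card_le_card hcover).trans ((Finset.card_union_le _ _).trans
    (Nat.add_le_add_left (Finset.card_union_le _ _) _))
  have hMcard : R.card ≤ 2 * M.card := by omega
  have hMne : M.Nonempty := Finset.card_pos.1 (by omega)
  have htwo : ∀ T ∈ rrbFinset R B, (M.filter fun x => x ∈ T).card ≤ 2 := by
    intro T hT
    obtain ⟨a, b, c, ha, hb, hc, hab, rfl⟩ := exists_eq_of_mem_rrbFinset hT
    refine (Finset.card_le_card (t := {a, b}) ?_).trans Finset.card_le_two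
    intro x hx
    simp only [hM, Finset.mem_filter, Finset.mem_insert, Finset.mem_singleton] at hx ⊢
    rcases hx.2 with h | h | rfl
    · exact Or.inl h
    · exact Or.inr h
    · exact absurd hc (Finset.disjoint_left.1 hRB hx.1.1)
  have hsum := sum_card_filter_mem_le _ _ 2 htwo
  obtain ⟨r, hr, hle⟩ := Finset.exists_le_of_sum_le hMne
    (f := fun r => ((rrbFinset R B).filter fun T => r ∈ T).card * M.card)
    (g := fun _ => 2 * (rrbFinset R B).card) (by
      rw [← Finset.sum_mul, Finset.sum_const, smul_eq_mul, mul_comm]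
      exact Nat.mul_le_mul_left _ hsum)
  obtain ⟨hrR, hr1, hr2⟩ := Finset.mem_filter.1 hr
  refine ⟨r, hrR, hr1, hr2, ?_⟩
  have := Nat.mul_le_mul_left ((rrbFinset R B).filter fun T => r ∈ T).card hMcard
  nlinarith

theorem exists_colorChange_fan {R B : Finset ℂ} (hRB : Disjoint R B) (hS : GenPos (↑R ∪ ↑B))
    {u r : ℂ} (hu : u ≠ 0) (hr : r ∈ R) :
    ∃ l : List ℂ, l.Nodup ∧ (∀ x, x ∈ l ↔ x ∈ R ∪ B ∧ linForm u r < linForm u x) ∧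
      l.Pairwise (fun x y => 0 < cross r x y) ∧
      adjCount (fun x y => decide (x ∈ R) != decide (y ∈ R)) l ≤
        ((rrbFinset R B).filter fun T => r ∈ T).card := by
  obtain ⟨l, _, hnd, -, hm, -, hl, -, hadj⟩ := exists_double_fan hRB hS hu (C := R ∪ B) subset_rfl
    (fun _ _ _ _ _ _ s hs _ => hs) (Finset.mem_union_left _ hr)
    (fun x y => decide (x ∈ R) != decide (y ∈ R)) (by
      intro x hx y hy hxy hxr hyr h
      rw [Finset.mem_union] at hx hy
      by_cases hxR : x ∈ R
      · have hyR : y ∉ R := by intro hyR; simp [hxR, hyR] at h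
        exact ⟨r, x, y, hr, hxR, hy.resolve_left hyR, hxr.symm, rfl⟩
      · have hyR : y ∈ R := by by_contra hyR; simp [hxR, hyR] at h
        exact ⟨r, y, x, hr, hyR, hx.resolve_left hxR, hyr.symm, by rw [Finset.pair_comm]⟩)
  refine ⟨l, hnd, hm, hl, (Nat.le_add_right _ _).trans (hadj.trans (Finset.card_le_card ?_))⟩
  exact Finset.monotone_filter_right _ fun T _ h => h.1

theorem rrb_dichotomy_of_side {R B : Finset ℂ} (hRB : Disjoint R B) (hS : GenPos (↑R ∪ ↑B))
    {u r : ℂ} (hu : u ≠ 0) (hr : r ∈ R) {Q D : ℕ} (hQ : 6 ≤ Q) (hD : 6 ≤ D)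
    (hside : (R.filter fun x => linForm u r < linForm u x).card ≤
      2 * (B.filter fun x => linForm u r < linForm u x).card) :
    D * D ≤ 8 * (rrbFinset R B).card ∨
      Q * (R.filter fun x => linForm u r < linForm u x).card ≤ 8 * (rrbFinset R B).card +
        Q * Q * (((rrbFinset R B).filter fun T => r ∈ T).card + 1) + Q * D := by
  obtain ⟨l, hnd, hm, hl, hadj⟩ := exists_colorChange_fan hRB hS hu hr
  have hdis := Finset.disjoint_left.1 hRB
  have key := rrb_dichotomy hRB hS hnd hm hl hQ hD
  have hq : l.countP (fun x => decide (x ∈ R)) =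
      (R.filter fun x => linForm u r < linForm u x).card := by
    rw [countP_eq_card_filter hnd ((R ∪ B).filter fun x => linForm u r < linForm u x)
      (by simpa using hm)]
    congr 1
    ext x
    simp only [Finset.mem_filter, Finset.mem_union, decide_eq_true_eq]
    tauto
  have hk : l.countP (fun x => !decide (x ∈ R)) =
      (B.filter fun x => linForm u r < linForm u x).card := by
    rw [countP_eq_card_filter hnd ((R ∪ B).filter fun x => linForm u r < linForm u x)
      (by simpa using hm)]
    congr 1
    ext x
    have := @hdis x
    simp only [Finset.mem_filter, Finset.mem_union, Bool.not_eq_true', decide_eq_false_iff_not]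
    tauto
  rw [hq, hk] at key
  refine (key hside).imp_right fun h => h.trans ?_
  gcongr

theorem cube_sqrt_le_card_rrb {R B : Finset ℂ} (hRB : Disjoint R B) (hS : GenPos (↑R ∪ ↑B))
    (hcard : R.card ≤ B.card) (hQ : 100 ≤ Nat.sqrt R.card) :
    Nat.sqrt R.card ^ 3 ≤ 200 * (rrbFinset R B).card := by
  obtain ⟨u, hu, hinj⟩ := exists_linForm_injOn (R ∪ B)
  have hsq := Nat.sqrt_le R.card
  set Q := Nat.sqrt R.card with hQdef
  have hn : 10000 ≤ R.card := le_trans (Nat.mul_le_mul hQ hQ) hsq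
  obtain ⟨r, hr, h₁, h₂, hN⟩ := exists_middle_red hRB (by omega)
    (hinj.mono (by simp) : Set.InjOn (linForm u) R)
  have finish : ∀ ρ, R.card / 4 ≤ ρ →
      ((ρ / 2) * (ρ / 2) ≤ 8 * (rrbFinset R B).card ∨ Q * ρ ≤ 8 * (rrbFinset R B).card +
        Q * Q * (((rrbFinset R B).filter fun T => r ∈ T).card + 1) + Q * (ρ / 2)) →
      Q ^ 3 ≤ 200 * (rrbFinset R B).card := by
    intro ρ hρ h
    have hD : Q * Q ≤ 9 * (ρ / 2) := by omega
    generalize (rrbFinset R B).card = N at *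
    generalize ((rrbFinset R B).filter fun T => r ∈ T).card = Nr at *
    have hD' : 2 * (ρ / 2) ≤ ρ := by omega
    generalize ρ / 2 = D at *
    rcases h with h | h
    · have := Nat.mul_le_mul hD hD
      have h4 : Q * Q * (Q * 100) ≤ Q * Q * (Q * Q) :=
        Nat.mul_le_mul_left _ (Nat.mul_le_mul_left _ hQ)
      nlinarith
    · have h5 : Q * Q * Nr ≤ 4 * N := by
        calc Q * Q * Nr ≤ R.card * Nr := Nat.mul_le_mul_right _ hsq
          _ ≤ 4 * N := by rw [mul_comm]; exact hN
      have h6 := Nat.mul_le_mul_left Q hD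
      have h7 := Nat.mul_le_mul_left Q hD'
      have h8 : Q * Q * 100 ≤ Q * Q * Q := Nat.mul_le_mul_left _ hQ
      nlinarith
  have hD : 6 ≤ R.card / 4 / 2 := by omega
  have sR := card_filter_lt_add_card_filter_gt hinj Finset.subset_union_left
    (Finset.mem_union_left B hr)
  have sB := card_filter_lt_add_card_filter_gt hinj Finset.subset_union_right
    (Finset.mem_union_left B hr)
  rw [if_neg (Finset.disjoint_left.1 hRB hr)] at sB
  rw [if_pos hr] at sR
  rcases le_total (B.filter fun x => linForm u x < linForm u r).card
    (B.filter fun x => linForm u r < linForm u x).card with h | h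
  · exact finish _ h₁ (rrb_dichotomy_of_side hRB hS hu hr (by omega) (by omega) (by omega))
  · have := rrb_dichotomy_of_side hRB hS (neg_ne_zero.2 hu) hr (Q := Q)
      (D := (R.filter fun x => linForm u x < linForm u r).card / 2) (by omega) (by omega)
    simp only [linForm_neg, neg_lt_neg_iff] at this
    exact finish _ h₂ (this (by omega))

theorem card_rrb_pos_of_side {R B : Finset ℂ} (hRB : Disjoint R B) (hS : GenPos (↑R ∪ ↑B))
    {u r x y : ℂ} (hu : u ≠ 0) (hr : r ∈ R) (hx : x ∈ R) (hy : y ∈ B)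
    (hrx : linForm u r < linForm u x) (hry : linForm u r < linForm u y) :
    0 < (rrbFinset R B).card := by
  obtain ⟨l, -, hm, -, hadj⟩ := exists_colorChange_fan hRB hS hu hr
  have := adjCount_pos_of_mem (fun x => decide (x ∈ R)) l x y
    ((hm x).2 ⟨Finset.mem_union_left _ hx, hrx⟩) ((hm y).2 ⟨Finset.mem_union_right _ hy, hry⟩)
    (by simpa using hx) (by simpa using Finset.disjoint_right.1 hRB hy)
  exact this.trans_le (hadj.trans (Finset.card_filter_le _ _))

theorem card_rrb_pos {R B : Finset ℂ} (hRB : Disjoint R B) (hS : GenPos (↑R ∪ ↑B))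
    (hR : 2 ≤ R.card) (hB : B.Nonempty) : 0 < (rrbFinset R B).card := by
  obtain ⟨u, hu, hinj⟩ := exists_linForm_injOn (R ∪ B)
  have hRne : R.Nonempty := Finset.card_pos.1 (by omega)
  obtain ⟨r, hr, hmin⟩ := R.exists_min_image (linForm u) hRne
  obtain ⟨s, hs, hmax⟩ := R.exists_max_image (linForm u) hRne
  have hrs : linForm u r < linForm u s := by
    refine lt_of_le_of_ne (hmin s hs) fun h => ?_
    have : R.card ≤ 1 := by
      refine Finset.card_le_one.2 fun x hx y hy => ?_
      refine hinj (by simp [hx]) (by simp [hy]) ?_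
      have := hmin x hx
      have := hmin y hy
      have := hmax x hx
      have := hmax y hy
      linarith
    omega
  obtain ⟨y, hy⟩ := hB
  rcases lt_or_ge (linForm u r) (linForm u y) with h | h
  · exact card_rrb_pos_of_side hRB hS hu hr hs hy hrs h
  · refine card_rrb_pos_of_side hRB hS (neg_ne_zero.2 hu) hs hr hy ?_ ?_
    · simpa [linForm_neg] using hrs
    · simpa [linForm_neg] using h.trans_lt hrs

end Counting

/-- There is an absolute constant `c > 0` such that for all disjoint finite sets `R, B`
in the plane with `|R| = n`, `|B| = m`, `m ≥ n ≥ 2`, and `R ∪ B` in general position,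
the number of empty red-red-blue triangles is at least `c · n^{3/2}`. -/
theorem stmt_11 :
    ∃ c : ℝ, 0 < c ∧ ∀ (R B : Finset ℂ) (n m : ℕ),
      R.card = n → B.card = m → 2 ≤ n → n ≤ m →
      Disjoint R B → GenPos (↑R ∪ ↑B) →
      c * (n : ℝ) ^ ((3 : ℝ) / 2) ≤ ((emptyRRB R B).ncard : ℝ) := by
  refine ⟨1 / 1000000, by norm_num, ?_⟩
  rintro R B n m hn rfl h2 hnm hRB hS
  have hN : ((rrbFinset R B).card : ℝ) ≤ ((emptyRRB R B).ncard : ℝ) := by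
    exact_mod_cast card_rrbFinset_le R B
  refine le_trans ?_ hN
  have hpow : (n : ℝ) ^ ((3 : ℝ) / 2) = √(n : ℝ) ^ 3 := by
    rw [Real.sqrt_eq_rpow, ← Real.rpow_natCast, ← Real.rpow_mul (Nat.cast_nonneg n)]
    norm_num
  have hsqrt : √(n : ℝ) ≤ (Nat.sqrt n : ℝ) + 1 := by
    rw [Real.sqrt_le_left (by positivity)]
    have := (Nat.lt_succ_sqrt n).le
    rw [pow_two]
    exact_mod_cast this
  rw [hpow]
  have hcube : √(n : ℝ) ^ 3 ≤ ((Nat.sqrt n : ℝ) + 1) ^ 3 :=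
    pow_le_pow_left₀ (Real.sqrt_nonneg _) hsqrt 3
  rcases le_or_gt 100 (Nat.sqrt n) with hQ | hQ
  · have h : ((Nat.sqrt n : ℝ)) ^ 3 ≤ 200 * (rrbFinset R B).card := by
      subst hn
      exact_mod_cast cube_sqrt_le_card_rrb hRB hS hnm hQ
    have hQ' : (100 : ℝ) ≤ Nat.sqrt n := by exact_mod_cast hQ
    have h8 : ((Nat.sqrt n : ℝ) + 1) ^ 3 ≤ (2 * (Nat.sqrt n : ℝ)) ^ 3 :=
      pow_le_pow_left₀ (by positivity) (by linarith) 3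
    rw [mul_pow] at h8
    linarith
  · have hpos : (1 : ℝ) ≤ (rrbFinset R B).card := by
      exact_mod_cast card_rrb_pos hRB hS (by omega) (Finset.card_pos.1 (by omega))
    have hQ' : (Nat.sqrt n : ℝ) + 1 ≤ 100 := by exact_mod_cast hQ
    have h8 : ((Nat.sqrt n : ℝ) + 1) ^ 3 ≤ (100 : ℝ) ^ 3 :=
      pow_le_pow_left₀ (by positivity) hQ' 3
    linarith
end

section
/- Let P ⊂ ℝ² be a set of 2n points in general position, and let P = R ∪ B be any partition into color classes with |R| = |B| = n ≥ 2. Then the number of empty triangles with exactly two red vertices and one blue vertex is at least c·n^{3/2} for an absolute constant c > 0. -/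
/-- `σ` times twice the signed area of the triangle `x y z`. -/
def orient (σ : ℝ) (x y z : ℂ) : ℝ :=
  σ * ((y - x).re * (z - x).im - (y - x).im * (z - x).re)

/-- The point `p` lies strictly inside the triangle `x y z`, which has positive orientation. -/
def InTriangle (σ : ℝ) (x y z p : ℂ) : Prop :=
  0 < orient σ x y p ∧ 0 < orient σ y z p ∧ 0 < orient σ z x p

section Orientation

variable {σ : ℝ} {x y z a p q s : ℂ}

theorem orient_rotate (σ : ℝ) (x y z : ℂ) : orient σ x y z = orient σ y z x := by
  simp only [orient, Complex.sub_re, Complex.sub_im]; ring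

theorem orient_swap (σ : ℝ) (x y z : ℂ) : orient σ x z y = -orient σ x y z := by
  simp only [orient, Complex.sub_re, Complex.sub_im]; ring

theorem orient_neg (σ : ℝ) (x y z : ℂ) : orient (-σ) x y z = -orient σ x y z := by
  simp only [orient]; ring

@[simp] theorem orient_self_left (σ : ℝ) (x y : ℂ) : orient σ x x y = 0 := by
  simp [orient]

@[simp] theorem orient_self_right (σ : ℝ) (x y : ℂ) : orient σ x y y = 0 := by
  simp only [orient]; ring

@[simp] theorem orient_self_outer (σ : ℝ) (x y : ℂ) : orient σ x y x = 0 := by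
  simp [orient]

theorem orient_add_orient_add_orient (σ : ℝ) (x y z p : ℂ) :
    orient σ x y p + orient σ y z p + orient σ z x p = orient σ x y z := by
  simp only [orient, Complex.sub_re, Complex.sub_im]; ring

/-- The barycentric expansion of the affine function `orient σ u v`. -/
theorem orient_barycentric (σ : ℝ) (u v x y z p : ℂ) :
    orient σ u v p * orient σ x y z = orient σ u v x * orient σ y z p +
      orient σ u v y * orient σ z x p + orient σ u v z * orient σ x y p := by
  simp only [orient, Complex.sub_re, Complex.sub_im]; ring

/-- The Plücker relation at the apex `x`. -/
theorem orient_plucker (σ : ℝ) (x a p q s : ℂ) :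
    orient σ x a q * orient σ x p s =
      orient σ x a p * orient σ x q s + orient σ x a s * orient σ x p q := by
  simp only [orient, Complex.sub_re, Complex.sub_im]; ring

theorem orient_trans (hp : 0 < orient σ x a p) (hq : 0 < orient σ x a q)
    (hs : 0 < orient σ x a s) (hpq : 0 < orient σ x p q) (hqs : 0 < orient σ x q s) :
    0 < orient σ x p s := by
  have h := orient_plucker σ x a p q s
  refine pos_of_mul_pos_right (a := orient σ x a q) ?_ hq.le
  rw [h]; positivity

theorem orient_ne_zero_of_not_collinear (hσ : σ ≠ 0) (hxy : x ≠ y)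
    (h : ¬ Collinear ℝ ({x, y, z} : Set ℂ)) : orient σ x y z ≠ 0 := by
  intro h0
  apply h
  rw [collinear_iff_of_mem (p₀ := x) (by simp)]
  have h1 : (y - x).re * (z - x).im = (y - x).im * (z - x).re := by
    rcases mul_eq_zero.1 h0 with h2 | h2
    · exact absurd h2 hσ
    · linarith
  have hne : y - x ≠ 0 := sub_ne_zero.2 hxy.symm
  obtain ⟨t, ht⟩ : ∃ t : ℝ, z = t • (y - x) + x := by
    by_cases hre : (y - x).re = 0
    · have him : (y - x).im ≠ 0 := fun him => hne (Complex.ext hre him)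
      refine ⟨(z - x).im / (y - x).im, Complex.ext ?_ ?_⟩
      · rw [hre, zero_mul, eq_comm, mul_eq_zero] at h1
        have := h1.resolve_left him
        simp only [Complex.add_re, Complex.real_smul, Complex.re_ofReal_mul, hre]
        simp only [Complex.sub_re] at this
        linarith
      · simp only [Complex.add_im, Complex.real_smul, Complex.im_ofReal_mul]
        rw [div_mul_cancel₀ _ him, Complex.sub_im]; ring
    · refine ⟨(z - x).re / (y - x).re, Complex.ext ?_ ?_⟩
      · simp only [Complex.add_re, Complex.real_smul, Complex.re_ofReal_mul]
        rw [div_mul_cancel₀ _ hre, Complex.sub_re]; ring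
      · simp only [Complex.add_im, Complex.real_smul, Complex.im_ofReal_mul]
        have : (z - x).re / (y - x).re * (y - x).im = (z - x).im := by
          field_simp
          linarith
        rw [this, Complex.sub_im]; ring
  refine ⟨y - x, ?_⟩
  rintro w (rfl | rfl | rfl)
  · exact ⟨0, by simp⟩
  · exact ⟨1, by simp⟩
  · exact ⟨t, ht⟩

/-- The cotangent of the angle at `x` from the direction of `a` to the direction of `p`. -/
noncomputable def cotKey (σ : ℝ) (x a p : ℂ) : ℝ :=
  ((a - x).re * (p - x).re + (a - x).im * (p - x).im) / orient σ x a p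

theorem cotKey_lt_iff (hp : 0 < orient σ x a p) (hq : 0 < orient σ x a q) :
    cotKey σ x a q < cotKey σ x a p ↔ 0 < orient σ x p q := by
  have hne : a - x ≠ 0 := by
    intro h
    rw [sub_eq_zero.1 h, orient_self_left] at hp
    exact lt_irrefl _ hp
  have hpos : 0 < (a - x).re ^ 2 + (a - x).im ^ 2 := by
    have := Complex.normSq_pos.2 hne
    rw [Complex.normSq_apply] at this
    nlinarith
  have key : ((a - x).re * (p - x).re + (a - x).im * (p - x).im) * orient σ x a q
      - ((a - x).re * (q - x).re + (a - x).im * (q - x).im) * orient σ x a p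
      = ((a - x).re ^ 2 + (a - x).im ^ 2) * orient σ x p q := by
    simp only [orient]; ring
  rw [cotKey, cotKey, div_lt_div_iff₀ hq hp, ← sub_pos, key]
  exact mul_pos_iff_of_pos_left hpos

theorem exists_first {S : Finset ℂ} (hS : S.Nonempty) (h : ∀ p ∈ S, 0 < orient σ x a p) :
    ∃ q ∈ S, ∀ p ∈ S, ¬ 0 < orient σ x p q := by
  obtain ⟨q, hq, hmax⟩ := S.exists_max_image (cotKey σ x a) hS
  exact ⟨q, hq, fun p hp hpq =>
    absurd ((cotKey_lt_iff (h p hp) (h q hq)).2 hpq) (hmax p hp).not_gt⟩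

theorem exists_last {S : Finset ℂ} (hS : S.Nonempty) (h : ∀ p ∈ S, 0 < orient σ x a p) :
    ∃ q ∈ S, ∀ p ∈ S, ¬ 0 < orient σ x q p := by
  obtain ⟨q, hq, hmin⟩ := S.exists_min_image (cotKey σ x a) hS
  exact ⟨q, hq, fun p hp hpq =>
    absurd ((cotKey_lt_iff (h q hq) (h p hp)).2 hpq) (hmin p hp).not_gt⟩

end Orientation

theorem Finset.exists_card_filter_lt_eq {α : Type*} [DecidableEq α] (f : α → ℝ) :
    ∀ (j : ℕ) (S : Finset α), Set.InjOn f S → j < S.card →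
      ∃ b ∈ S, (S.filter fun c => f b < f c).card = j := by
  intro j
  induction j with
  | zero =>
    intro S _ hS
    obtain ⟨b, hb, hmax⟩ := S.exists_max_image f (Finset.card_pos.1 hS)
    refine ⟨b, hb, ?_⟩
    rw [Finset.card_eq_zero, Finset.filter_eq_empty_iff]
    exact fun c hc => (hmax c hc).not_gt
  | succ j ih =>
    intro S hf hS
    obtain ⟨a, ha, hmax⟩ := S.exists_max_image f (Finset.card_pos.1 (by omega))
    obtain ⟨b, hb, hcard⟩ := ih (S.erase a) (hf.mono (by simp))
      (by rw [Finset.card_erase_of_mem ha]; omega)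
    have hbS := Finset.mem_of_mem_erase hb
    refine ⟨b, hbS, ?_⟩
    have hlt : f b < f a := lt_of_le_of_ne (hmax b hbS)
      fun h => Finset.ne_of_mem_erase hb (hf hbS ha h)
    rw [Finset.filter_erase, Finset.card_erase_of_mem (by simp [ha, hlt])] at hcard
    have : 0 < (S.filter fun c => f b < f c).card := Finset.card_pos.2 ⟨a, by simp [ha, hlt]⟩
    omega

/-- All triples of distinct points of `R ∪ B` are affinely independent. -/
def NondegOrient (σ : ℝ) (R B : Finset ℂ) : Prop :=
  ∀ x y z : ℂ, x ∈ R ∨ x ∈ B → y ∈ R ∨ y ∈ B → z ∈ R ∨ z ∈ B → x ≠ y → x ≠ z → y ≠ z →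
    orient σ x y z ≠ 0

open Classical in
/-- Empty triangles `(r, b, r')` of positive orientation with `r, r'` red and `b` blue. -/
noncomputable def emptyTriples (σ : ℝ) (R B : Finset ℂ) : Finset (ℂ × ℂ × ℂ) :=
  (R ×ˢ B ×ˢ R).filter fun t => 0 < orient σ t.1 t.2.1 t.2.2 ∧
    ∀ p, p ∈ R ∨ p ∈ B → ¬ InTriangle σ t.1 t.2.1 t.2.2 p

theorem mem_emptyTriples {σ : ℝ} {R B : Finset ℂ} {r b s : ℂ} :
    (r, b, s) ∈ emptyTriples σ R B ↔ r ∈ R ∧ b ∈ B ∧ s ∈ R ∧ 0 < orient σ r b s ∧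
      ∀ p, p ∈ R ∨ p ∈ B → ¬ InTriangle σ r b s p := by
  simp [emptyTriples, and_assoc]

theorem convex_orient_nonneg (σ : ℝ) (x y : ℂ) : Convex ℝ {p | 0 ≤ orient σ x y p} := by
  intro p hp q hq α β hα hβ hαβ
  simp only [Set.mem_ofPred_eq] at *
  have hβ' : β = 1 - α := by linarith
  have : orient σ x y (α • p + β • q) = α * orient σ x y p + β * orient σ x y q := by
    subst hβ'
    simp only [orient, Complex.sub_re, Complex.sub_im, Complex.add_re, Complex.add_im,
      Complex.real_smul, Complex.re_ofReal_mul, Complex.im_ofReal_mul]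
    ring
  rw [this]; positivity

theorem convexHull_triple_inter_eq {σ : ℝ} {R B : Finset ℂ} (hgp : NondegOrient σ R B)
    {x y z : ℂ} (hx : x ∈ R ∨ x ∈ B) (hy : y ∈ R ∨ y ∈ B) (hz : z ∈ R ∨ z ∈ B)
    (hpos : 0 < orient σ x y z) (hemp : ∀ p, p ∈ R ∨ p ∈ B → ¬ InTriangle σ x y z p) :
    convexHull ℝ {x, y, z} ∩ (↑R ∪ ↑B : Set ℂ) = ({x, y, z} : Set ℂ) := by
  have hxy : x ≠ y := by rintro rfl; simp at hpos
  have hxz : x ≠ z := by rintro rfl; simp at hpos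
  have hyz : y ≠ z := by rintro rfl; simp at hpos
  apply Set.Subset.antisymm
  · rintro p ⟨hp, hpRB⟩
    by_contra hne
    simp only [Set.mem_insert_iff, Set.mem_singleton_iff, not_or] at hne
    obtain ⟨h1, h2, h3⟩ := hne
    have hsub : convexHull ℝ ({x, y, z} : Set ℂ) ⊆
        {p | 0 ≤ orient σ x y p} ∩ ({p | 0 ≤ orient σ y z p} ∩ {p | 0 ≤ orient σ z x p}) := by
      refine convexHull_min ?_ ((convex_orient_nonneg σ x y).inter
        ((convex_orient_nonneg σ y z).inter (convex_orient_nonneg σ z x)))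
      have e1 := orient_rotate σ x y z
      have e2 := orient_rotate σ y z x
      rintro w (rfl | rfl | rfl) <;> simp <;> linarith
    obtain ⟨g1, g2, g3⟩ := hsub hp
    have hpP : p ∈ R ∨ p ∈ B := by simpa using hpRB
    exact hemp p hpP ⟨lt_of_le_of_ne g1 (hgp x y p hx hy hpP hxy (Ne.symm h1) (Ne.symm h2)).symm,
      lt_of_le_of_ne g2 (hgp y z p hy hz hpP hyz (Ne.symm h2) (Ne.symm h3)).symm,
      lt_of_le_of_ne g3 (hgp z x p hz hx hpP hxz.symm (Ne.symm h3) (Ne.symm h1)).symm⟩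
  · intro p hp
    refine ⟨subset_convexHull ℝ _ hp, ?_⟩
    rcases hp with rfl | rfl | rfl <;> simpa

theorem card_emptyTriples_le {σ : ℝ} {R B : Finset ℂ} (hgp : NondegOrient σ R B)
    (hd : Disjoint R B) : (emptyTriples σ R B).card ≤ (emptyRRB R B).ncard := by
  have hfin : (emptyRRB R B).Finite := by
    refine ((R.finite_toSet.union B.finite_toSet).finite_subsets).subset ?_
    rintro T ⟨a, b, c, ha, hb, hc, -, rfl, -⟩ w (rfl | rfl | rfl) <;> simp [*]
  have hinj : Set.InjOn (fun t : ℂ × ℂ × ℂ => ({t.1, t.2.2, t.2.1} : Set ℂ))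
      (emptyTriples σ R B) := by
    rintro ⟨r, b, s⟩ h ⟨r', b', s'⟩ h' heq
    rw [Finset.mem_coe, mem_emptyTriples] at h h'
    obtain ⟨hr, hb, hs, hpos, -⟩ := h
    obtain ⟨hr', hb', hs', hpos', -⟩ := h'
    have hRB : ∀ u ∈ R, ∀ v ∈ B, u ≠ v := fun u hu v hv => Finset.disjoint_iff_ne.1 hd u hu v hv
    simp only at heq
    have m1 : b ∈ ({r', s', b'} : Set ℂ) := heq ▸ (by simp)
    have m2 : r ∈ ({r', s', b'} : Set ℂ) := heq ▸ (by simp)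
    have m3 : s ∈ ({r', s', b'} : Set ℂ) := heq ▸ (by simp)
    have hbb : b = b' := by
      rcases m1 with h | h | h
      · exact absurd h.symm (hRB r' hr' b hb)
      · exact absurd h.symm (hRB s' hs' b hb)
      · exact h
    subst hbb
    have hrs : r ≠ s := by rintro rfl; simp at hpos
    have hrb := hRB r hr b hb
    have hsb := hRB s hs b hb
    rcases m2 with rfl | rfl | h
    · rcases m3 with h | rfl | h
      · exact absurd h.symm hrs
      · rfl
      · exact absurd h hsb
    · rcases m3 with rfl | h | h
      · rw [orient_rotate, orient_rotate, orient_swap] at hpos'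
        linarith
      · exact absurd h.symm hrs
      · exact absurd h hsb
    · exact absurd h hrb
  calc (emptyTriples σ R B).card = ((emptyTriples σ R B : Set (ℂ × ℂ × ℂ))).ncard :=
        (Set.ncard_coe_finset _).symm
    _ = _ := hinj.ncard_image.symm
    _ ≤ _ := by
      refine Set.ncard_le_ncard ?_ hfin
      rintro _ ⟨⟨r, b, s⟩, h, rfl⟩
      rw [Finset.mem_coe, mem_emptyTriples] at h
      obtain ⟨hr, hb, hs, hpos, hemp⟩ := h
      have hset : ({r, s, b} : Set ℂ) = {r, b, s} := by rw [Set.pair_comm]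
      refine ⟨r, s, b, hr, hs, hb, ?_, rfl, ?_⟩
      · rintro rfl; simp at hpos
      · rw [hset]
        exact convexHull_triple_inter_eq hgp (.inl hr) (.inr hb) (.inl hs) hpos hemp

theorem emptyTriples_nonempty {σ : ℝ} {R B : Finset ℂ} {r b s : ℂ} (hr : r ∈ R) (hb : b ∈ B)
    (hs : s ∈ R) (hpos : 0 < orient σ r b s) : (emptyTriples σ R B).Nonempty := by
  have hne : ((R ×ˢ B ×ˢ R).filter fun t => 0 < orient σ t.1 t.2.1 t.2.2).Nonempty :=
    ⟨(r, b, s), by simp [*]⟩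
  obtain ⟨⟨x, y, z⟩, ht, hmin⟩ := Finset.exists_min_image _
    (fun t : ℂ × ℂ × ℂ => orient σ t.1 t.2.1 t.2.2) hne
  simp only [Finset.mem_filter, Finset.mem_product] at ht hmin
  obtain ⟨⟨hx, hy, hz⟩, hxyz⟩ := ht
  refine ⟨(x, y, z), mem_emptyTriples.2 ⟨hx, hy, hz, hxyz, ?_⟩⟩
  rintro p hp ⟨h1, h2, h3⟩
  have hsum := orient_add_orient_add_orient σ x y z p
  rcases hp with hp | hp
  · have := hmin (x, y, p) ⟨⟨hx, hy, hp⟩, h1⟩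
    simp only at this
    linarith
  · have e : orient σ x p z = orient σ z x p := (orient_rotate σ z x p).symm
    have := hmin (x, p, z) ⟨⟨hx, hp, hz⟩, by simpa only [e] using h3⟩
    simp only [e] at this
    linarith

/-- In a set closed under passing to points inside its red-red-blue triangles, each blue point
has many empty triangles, unless blue is as frequent as red. -/
theorem card_le_card_emptyTriples_fiber_add {σ : ℝ} {R B RC BC : Finset ℂ}
    (hgp : NondegOrient σ R B) (hd : Disjoint R B) (hRC : RC ⊆ R) (hBC : BC ⊆ B) {b : ℂ}
    (hb : b ∈ BC)
    (hC : ∀ x ∈ RC, ∀ y ∈ RC, ∀ p, p ∈ R ∨ p ∈ B → InTriangle σ y b x p → p ∈ RC ∨ p ∈ BC) :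
    RC.card ≤ ((emptyTriples σ R B).filter fun t => t.2.1 = b).card + BC.card := by
  classical
  have hbR : ∀ x ∈ RC, b ≠ x := fun x hx =>
    (Finset.disjoint_iff_ne.1 hd x (hRC hx) b (hBC hb)).symm
  have hne : ∀ x ∈ RC, ∀ y ∈ RC, x ≠ y → orient σ b x y ≠ 0 := fun x hx y hy hxy =>
    hgp b x y (.inr (hBC hb)) (.inl (hRC hx)) (.inl (hRC hy)) (hbR x hx) (hbR y hy) hxy
  set RS := RC.filter fun x => ∃ s ∈ RC, 0 < orient σ b x s with hRS
  have hsucc : ∀ x ∈ RS, ∃ q ∈ RC, 0 < orient σ b x q ∧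
      ∀ p ∈ RC, 0 < orient σ b x p → ¬ 0 < orient σ b p q := by
    intro x hx
    obtain ⟨-, s, hs, hxs⟩ := Finset.mem_filter.1 hx
    obtain ⟨q, hq, hfirst⟩ := exists_first (σ := σ) (x := b) (a := x)
      (S := RC.filter fun s => 0 < orient σ b x s) ⟨s, by simp [hs, hxs]⟩
      (fun p hp => (Finset.mem_filter.1 hp).2)
    obtain ⟨hq, hxq⟩ := Finset.mem_filter.1 hq
    exact ⟨q, hq, hxq, fun p hp hxp => hfirst p (by simp [hp, hxp])⟩
  choose! s hsR hspos hsfirst using hsucc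
  have hRSR : ∀ x ∈ RS, x ∈ RC := fun x hx => (Finset.mem_filter.1 hx).1
  have h1 : RC.card ≤ RS.card + 1 := by
    rw [← Finset.card_filter_add_card_filter_not (s := RC) fun x => ∃ s ∈ RC, 0 < orient σ b x s]
    gcongr
    rw [Finset.card_le_one]
    intro x hx y hy
    simp only [Finset.mem_filter, not_exists, not_and] at hx hy
    by_contra hxy
    have h0 := hne x hx.1 y hy.1 hxy
    have hx' := hx.2 y hy.1
    have hy' := hy.2 x hx.1
    rw [orient_swap] at hy'
    exact h0 (by linarith)
  have hbad : (RS.filter fun x => ∃ p ∈ BC, InTriangle σ (s x) b x p).card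
      ≤ (BC.erase b).card := by
    have hp : ∀ x ∈ RS.filter fun x => ∃ p ∈ BC, InTriangle σ (s x) b x p,
        ∃ p ∈ BC, InTriangle σ (s x) b x p := fun x hx => (Finset.mem_filter.1 hx).2
    choose! f hfB hfT using hp
    refine Finset.card_le_card_of_injOn f ?_ ?_
    · intro x hx
      refine Finset.mem_coe.2 (Finset.mem_erase.2 ⟨?_, hfB x hx⟩)
      intro h
      have := (hfT x hx).1
      simp [h] at this
    · have key : ∀ x ∈ RS.filter fun x => ∃ p ∈ BC, InTriangle σ (s x) b x p,
          ∀ y ∈ RS.filter fun x => ∃ p ∈ BC, InTriangle σ (s x) b x p,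
          f x = f y → ¬ 0 < orient σ b x y := by
        intro x hx y hy hxy hpos
        have hx0 := (Finset.mem_filter.1 hx).1
        have hy0 := (Finset.mem_filter.1 hy).1
        have h2 := hfT x hx
        have h3 := hfT y hy
        rw [← hxy] at h3
        exact hsfirst x hx0 y (hRSR y hy0) hpos (orient_trans hpos h2.2.1 (hspos x hx0) h3.2.1
          (by rw [← orient_rotate]; exact h2.1))
      intro x hx y hy hxy
      by_contra hne'
      have h0 := hne x (hRSR x (Finset.mem_filter.1 hx).1) y
        (hRSR y (Finset.mem_filter.1 hy).1) hne'
      have k1 := key x hx y hy hxy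
      have k2 := key y hy x hx hxy.symm
      rw [orient_swap] at k2
      exact h0 (by linarith)
  have hgood : (RS.filter fun x => ¬ ∃ p ∈ BC, InTriangle σ (s x) b x p).card
      ≤ ((emptyTriples σ R B).filter fun t => t.2.1 = b).card := by
    refine Finset.card_le_card_of_injOn (fun x => (s x, b, x)) ?_ ?_
    · intro x hx
      obtain ⟨hx, hemp⟩ := Finset.mem_filter.1 hx
      have hxR := hRSR x hx
      refine Finset.mem_coe.2 (Finset.mem_filter.2 ⟨mem_emptyTriples.2
        ⟨hRC (hsR x hx), hBC hb, hRC hxR, ?_, ?_⟩, rfl⟩)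
      · rw [orient_rotate]; exact hspos x hx
      · intro p hp hpT
        rcases hC x hxR (s x) (hsR x hx) p hp hpT with h | h
        · exact hsfirst x hx p h hpT.2.1 (by rw [← orient_rotate]; exact hpT.1)
        · exact hemp ⟨p, h, hpT⟩
    · intro x _ y _ hxy
      simp only [Prod.mk.injEq] at hxy
      exact hxy.2.2
  have h2 := Finset.card_filter_add_card_filter_not (s := RS)
    fun x => ∃ p ∈ BC, InTriangle σ (s x) b x p
  have h3 := Finset.card_erase_add_one hb
  omega

theorem card_mul_card_le_card_emptyTriples_add {σ : ℝ} {R B RC BC : Finset ℂ}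
    (hgp : NondegOrient σ R B) (hd : Disjoint R B) (hRC : RC ⊆ R) (hBC : BC ⊆ B)
    (hC : ∀ b ∈ BC, ∀ x ∈ RC, ∀ y ∈ RC, ∀ p, p ∈ R ∨ p ∈ B → InTriangle σ y b x p →
      p ∈ RC ∨ p ∈ BC) :
    BC.card * RC.card ≤ (emptyTriples σ R B).card + BC.card * BC.card := by
  calc BC.card * RC.card = ∑ b ∈ BC, RC.card := by simp
    _ ≤ ∑ b ∈ BC, (((emptyTriples σ R B).filter fun t => t.2.1 = b).card + BC.card) :=
      Finset.sum_le_sum fun b hb =>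
        card_le_card_emptyTriples_fiber_add hgp hd hRC hBC hb (hC b hb)
    _ ≤ _ := by
      rw [Finset.sum_add_distrib, Finset.sum_card_fiberwise_eq_card_filter, Finset.sum_const,
        smul_eq_mul]
      gcongr
      exact Finset.filter_subset _ _

theorem InTriangle.orient_pos {σ : ℝ} {u v x y z p : ℂ} (h : InTriangle σ x y z p)
    (hx : 0 < orient σ u v x) (hy : 0 < orient σ u v y) (hz : 0 < orient σ u v z) :
    0 < orient σ u v p := by
  obtain ⟨h1, h2, h3⟩ := h
  have hpos : 0 < orient σ x y z := by
    rw [← orient_add_orient_add_orient σ x y z p]; positivity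
  refine pos_of_mul_pos_left (b := orient σ x y z) ?_ hpos.le
  rw [orient_barycentric]; positivity

open Classical in
/-- Blue points `b` such that `r b` is an edge of a triple in `emptyTriples σ R B`
starting at `r`. -/
noncomputable def goodNeighbors (σ : ℝ) (R B : Finset ℂ) (r : ℂ) : Finset ℂ :=
  B.filter fun b => ∃ s, (r, b, s) ∈ emptyTriples σ R B

open Classical in
theorem sum_card_goodNeighbors_le (σ : ℝ) (R B : Finset ℂ) :
    ∑ r ∈ R, (goodNeighbors σ R B r).card ≤ (emptyTriples σ R B).card := by
  calc ∑ r ∈ R, (goodNeighbors σ R B r).card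
      ≤ ∑ r ∈ R, ((emptyTriples σ R B).filter fun t => t.1 = r).card := by
        refine Finset.sum_le_sum fun r _ => ?_
        refine (Finset.card_le_card ?_).trans
          (Finset.card_image_le (f := fun t : ℂ × ℂ × ℂ => t.2.1))
        intro b hb
        obtain ⟨-, s, hs⟩ := Finset.mem_filter.1 hb
        exact Finset.mem_image.2 ⟨(r, b, s), by simp [hs], rfl⟩
    _ ≤ _ := by
      rw [Finset.sum_card_fiberwise_eq_card_filter]
      exact Finset.card_le_card (Finset.filter_subset _ _)

/-- Among the first blue points to the left of the ray from `r` through `b₀` one is a good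
neighbor of `r`, unless a convex region with a surplus of red points yields many empty
triangles. -/
theorem exists_goodNeighbor_or_le_card {σ : ℝ} {R B : Finset ℂ} (hgp : NondegOrient σ R B)
    (hd : Disjoint R B) {r b₀ : ℂ} (hr : r ∈ R) (hb₀ : b₀ ∈ B) {m : ℕ}
    (hm : m < (B.filter fun p => 0 < orient σ r b₀ p).card)
    (hle : (B.filter fun p => 0 < orient σ r b₀ p).card ≤
      (R.filter fun p => 0 < orient σ r b₀ p).card) :
    ((B.filter fun p => 0 < orient σ r b₀ p).card - (m + 1)) * (m + 1) ≤
        (emptyTriples σ R B).card ∨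
      ∃ b ∈ goodNeighbors σ R B r, b₀ = b ∨ (0 < orient σ r b₀ b ∧
        (B.filter fun p => 0 < orient σ r b₀ p ∧ 0 < orient σ r p b).card ≤ m) := by
  classical
  set HB := B.filter fun p => 0 < orient σ r b₀ p with hHB
  set HR := R.filter fun p => 0 < orient σ r b₀ p with hHR
  have hrB : ∀ p ∈ B, r ≠ p := fun p hp => Finset.disjoint_iff_ne.1 hd r hr p hp
  have hposB : ∀ p ∈ HB, 0 < orient σ r b₀ p := fun p hp => (Finset.mem_filter.1 hp).2
  have hposR : ∀ p ∈ HR, 0 < orient σ r b₀ p := fun p hp => (Finset.mem_filter.1 hp).2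
  have hHBB : HB ⊆ B := Finset.filter_subset _ _
  have hHRR : HR ⊆ R := Finset.filter_subset _ _
  have hne : ∀ x ∈ HB, ∀ y ∈ HB, x ≠ y → orient σ r x y ≠ 0 := fun x hx y hy hxy =>
    hgp r x y (.inl hr) (.inr (hHBB hx)) (.inr (hHBB hy)) (hrB x (hHBB hx)) (hrB y (hHBB hy)) hxy
  have hinj : Set.InjOn (cotKey σ r b₀) HB := by
    intro x hx y hy hxy
    by_contra hxy'
    have h1 := (cotKey_lt_iff (hposB x hx) (hposB y hy)).not.1 hxy.symm.not_lt
    have h2 := (cotKey_lt_iff (hposB y hy) (hposB x hx)).not.1 hxy.not_lt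
    rw [orient_swap] at h2
    exact hne x hx y hy hxy' (by linarith)
  obtain ⟨c, hc, hcard⟩ := Finset.exists_card_filter_lt_eq _ m HB hinj hm
  have hcard' : (HB.filter fun p => 0 < orient σ r p c).card = m := by
    rw [← hcard]
    congr 1
    exact Finset.filter_congr fun p hp => (cotKey_lt_iff (hposB p hp) (hposB c hc)).symm
  by_cases hS : (HR.filter fun p => 0 < orient σ r p c).Nonempty
  · right
    obtain ⟨q, hq, hfirst⟩ := exists_first hS fun p hp => hposR p (Finset.mem_filter.1 hp).1
    obtain ⟨hqR, hqc⟩ := Finset.mem_filter.1 hq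
    have good : ∀ b ∈ B, 0 < orient σ r b q →
        (∀ p, 0 < orient σ r b p → 0 < orient σ r p q → 0 < orient σ r b₀ p) →
        (∀ p ∈ HB, 0 < orient σ r p q → ¬ 0 < orient σ r b p) →
        b ∈ goodNeighbors σ R B r := by
      intro b hb hbq hleft hlast
      refine Finset.mem_filter.2 ⟨hb, q, mem_emptyTriples.2 ⟨hr, hb, hHRR hqR, hbq, ?_⟩⟩
      rintro p hp ⟨h1, -, h3⟩
      rw [orient_rotate] at h3
      have hp₀ := hleft p h1 h3
      rcases hp with hp | hp
      · refine hfirst p (Finset.mem_filter.2 ⟨Finset.mem_filter.2 ⟨hp, hp₀⟩, ?_⟩) h3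
        exact orient_trans hp₀ (hposR q hqR) (hposB c hc) h3 hqc
      · exact hlast p (Finset.mem_filter.2 ⟨hp, hp₀⟩) h3 h1
    by_cases hW : (HB.filter fun p => 0 < orient σ r p q).Nonempty
    · obtain ⟨b, hb, hlast⟩ := exists_last hW fun p hp => hposB p (Finset.mem_filter.1 hp).1
      obtain ⟨hbB, hbq⟩ := Finset.mem_filter.1 hb
      have hb₀b := hposB b hbB
      refine ⟨b, good b (hHBB hbB) hbq ?_ fun p hp hpq =>
        hlast p (Finset.mem_filter.2 ⟨hp, hpq⟩), .inr ⟨hb₀b, ?_⟩⟩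
      · intro p h1 h3
        refine pos_of_mul_pos_left (b := orient σ r b q) ?_ hbq.le
        rw [orient_barycentric σ r b₀ r b q p, orient_self_outer, orient_rotate σ q r p,
          zero_mul, zero_add]
        have := hposR q hqR
        positivity
      · rw [← hcard']
        refine Finset.card_le_card fun p hp => ?_
        obtain ⟨hpB, hp₀, hpb⟩ := Finset.mem_filter.1 hp
        have hbc := orient_trans hb₀b (hposR q hqR) (hposB c hc) hbq hqc
        exact Finset.mem_filter.2 ⟨Finset.mem_filter.2 ⟨hpB, hp₀⟩,
          orient_trans hp₀ hb₀b (hposB c hc) hpb hbc⟩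
    · refine ⟨b₀, good b₀ hb₀ (hposR q hqR) (fun p h _ => h) ?_, .inl rfl⟩
      intro p hp hpq
      exact absurd ⟨p, Finset.mem_filter.2 ⟨hp, hpq⟩⟩ hW
  · left
    have hS' : ∀ p ∈ HR, ¬ 0 < orient σ r p c := fun p hp hpc =>
      hS ⟨p, Finset.mem_filter.2 ⟨hp, hpc⟩⟩
    set BC := HB.filter fun p => 0 < orient σ r c p with hBC
    have hRc : ∀ p ∈ HR, 0 < orient σ r c p := by
      intro p hp
      have h1 : r ≠ p := by
        rintro rfl
        have := hposR r hp
        simp at this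
      have h2 := hgp r c p (.inl hr) (.inr (hHBB hc)) (.inl (hHRR hp)) (hrB c (hHBB hc)) h1
        (Finset.disjoint_iff_ne.1 hd p (hHRR hp) c (hHBB hc)).symm
      have h3 := hS' p hp
      rw [orient_swap] at h3
      exact lt_of_le_of_ne (by linarith) h2.symm
    have hBCcard : HB.card = m + 1 + BC.card := by
      rw [← hcard', ← Finset.card_filter_add_card_filter_not (s := HB)
        fun p => 0 < orient σ r p c, add_assoc, add_comm 1]
      congr 1
      rw [← Finset.card_erase_add_one (s := HB.filter fun p => ¬ 0 < orient σ r p c) (a := c)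
        (by simp [hc])]
      congr 2
      ext p
      simp only [hBC, Finset.mem_erase, Finset.mem_filter]
      constructor
      · rintro ⟨hpc, hp, hn⟩
        refine ⟨hp, lt_of_le_of_ne ?_ (hne c hc p hp (Ne.symm hpc)).symm⟩
        rw [orient_swap] at hn
        linarith
      · rintro ⟨hp, hcp⟩
        refine ⟨?_, hp, ?_⟩
        · rintro rfl
          simp at hcp
        · rw [orient_swap]
          linarith
    have hmain := card_mul_card_le_card_emptyTriples_add hgp hd hHRR
      ((Finset.filter_subset _ _ : BC ⊆ HB).trans hHBB) (by
        intro b hb x hx y hy p hp hT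
        obtain ⟨hbB, hcb⟩ := Finset.mem_filter.1 hb
        have h1 := hT.orient_pos (hposR y hy) (hposB b hbB) (hposR x hx)
        have h2 := hT.orient_pos (hRc y hy) hcb (hRc x hx)
        rcases hp with hp | hp
        · exact .inl (Finset.mem_filter.2 ⟨hp, h1⟩)
        · exact .inr (Finset.mem_filter.2 ⟨Finset.mem_filter.2 ⟨hp, h1⟩, h2⟩))
    have hsub : HB.card - (m + 1) = BC.card := by omega
    rw [hsub]
    have : BC.card * (m + 1 + BC.card) ≤ BC.card * HR.card := by gcongr; omega
    linarith [mul_add BC.card (m + 1) BC.card]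

theorem card_filter_orient_le_card {σ : ℝ} {R B : Finset ℂ} (hgp : NondegOrient σ R B)
    (hd : Disjoint R B) {r b : ℂ} (hr : r ∈ R) {m : ℕ} [DecidablePred fun b₀ => b₀ = b ∨
      (0 < orient σ r b₀ b ∧
        (B.filter fun p => 0 < orient σ r b₀ p ∧ 0 < orient σ r p b).card ≤ m)] :
    (B.filter fun b₀ => b₀ = b ∨ (0 < orient σ r b₀ b ∧
      (B.filter fun p => 0 < orient σ r b₀ p ∧ 0 < orient σ r p b).card ≤ m)).card ≤ m + 2 := by
  classical
  set S := B.filter fun b₀ => 0 < orient σ r b₀ b ∧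
    (B.filter fun p => 0 < orient σ r b₀ p ∧ 0 < orient σ r p b).card ≤ m with hS
  have hSB : S ⊆ B := Finset.filter_subset _ _
  have hrB : ∀ p ∈ B, r ≠ p := fun p hp => Finset.disjoint_iff_ne.1 hd r hr p hp
  have hScard : S.card ≤ m + 1 := by
    rcases S.eq_empty_or_nonempty with h | h
    · simp [h]
    obtain ⟨q, hq, hlast⟩ := exists_last (σ := -σ) (x := r) (a := b) h fun p hp => by
      rw [orient_neg, ← orient_swap]
      exact (Finset.mem_filter.1 hp).2.1
    obtain ⟨hqB, -, hqm⟩ := Finset.mem_filter.1 hq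
    rw [← Finset.card_erase_add_one hq]
    gcongr
    refine (Finset.card_le_card fun p hp => ?_).trans hqm
    obtain ⟨hpq, hp⟩ := Finset.mem_erase.1 hp
    have hpB := hSB hp
    refine Finset.mem_filter.2 ⟨hpB, ?_, (Finset.mem_filter.1 hp).2.1⟩
    have h1 := hgp r q p (.inl hr) (.inr hqB) (.inr hpB) (hrB q hqB) (hrB p hpB) hpq.symm
    have h2 := hlast p hp
    rw [orient_neg] at h2
    exact lt_of_le_of_ne (by linarith) h1.symm
  calc _ ≤ (insert b S).card := by
        refine Finset.card_le_card fun p hp => ?_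
        obtain ⟨hpB, h | h⟩ := Finset.mem_filter.1 hp
        · exact Finset.mem_insert.2 (.inl h)
        · exact Finset.mem_insert.2 (.inr (Finset.mem_filter.2 ⟨hpB, h⟩))
    _ ≤ S.card + 1 := Finset.card_insert_le _ _
    _ ≤ m + 2 := by omega

/-- A tournament in which all out-degrees are less than `k` has at most `2 * k` vertices. -/
theorem Finset.card_le_two_mul_of_tournament {α : Type*} [DecidableEq α] (S : Finset α)
    (D : α → α → Prop) [DecidableRel D] {k : ℕ} (hD : ∀ x ∈ S, ∀ y ∈ S, x ≠ y → D x y ∨ D y x)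
    (h : ∀ x ∈ S, (S.filter (D x)).card < k) : S.card ≤ 2 * k := by
  have h1 : ∀ x ∈ S, S.card ≤ (S.filter (D x)).card + (S.filter fun y => D y x).card + 1 := by
    intro x hx
    rw [← Finset.card_erase_add_one hx]
    gcongr
    refine (Finset.card_le_card fun y hy => ?_).trans (Finset.card_union_le _ _)
    obtain ⟨hyx, hy⟩ := Finset.mem_erase.1 hy
    rcases hD x hx y hy hyx.symm with h | h <;> simp [hy, h]
  have h2 : ∑ x ∈ S, (S.filter (D x)).card = ∑ x ∈ S, (S.filter fun y => D y x).card :=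
    Finset.sum_card_bipartiteAbove_eq_sum_card_bipartiteBelow D
  have h3 : ∑ x ∈ S, S.card ≤ _ := Finset.sum_le_sum h1
  have h4 : ∑ x ∈ S, ((S.filter (D x)).card + 1) ≤ ∑ x ∈ S, k := Finset.sum_le_sum h
  rw [Finset.sum_add_distrib, Finset.sum_add_distrib, ← h2] at h3
  rw [Finset.sum_add_distrib] at h4
  simp only [Finset.sum_const, smul_eq_mul, mul_one] at h3 h4
  rcases Nat.eq_zero_or_pos S.card with h0 | h0
  · omega
  · refine Nat.le_of_mul_le_mul_left ?_ h0
    linarith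

/-- Blue points `b` such that the line through `r` and `b` has at least `k` blue points on each
side. -/
noncomputable def deepPoints (B : Finset ℂ) (r : ℂ) (k : ℕ) : Finset ℂ :=
  B.filter fun b => k ≤ (B.filter fun p => 0 < orient 1 r b p).card ∧
    k ≤ (B.filter fun p => 0 < orient (-1) r b p).card

theorem card_filter_few_left_le {σ : ℝ} {R B : Finset ℂ} (hgp : NondegOrient σ R B)
    (hd : Disjoint R B) {r : ℂ} (hr : r ∈ R) (k : ℕ) :
    (B.filter fun b => (B.filter fun p => 0 < orient σ r b p).card < k).card ≤ 2 * k := by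
  classical
  refine Finset.card_le_two_mul_of_tournament _ (fun x y => 0 < orient σ r x y) ?_ ?_
  · intro x hx y hy hxy
    have hx := (Finset.mem_filter.1 hx).1
    have hy := (Finset.mem_filter.1 hy).1
    have h := hgp r x y (.inl hr) (.inr hx) (.inr hy) (Finset.disjoint_iff_ne.1 hd r hr x hx)
      (Finset.disjoint_iff_ne.1 hd r hr y hy) hxy
    rw [orient_swap σ r x y, neg_pos]
    exact h.lt_or_gt.symm
  · intro x hx
    refine (Finset.card_le_card ?_).trans_lt (Finset.mem_filter.1 hx).2
    exact Finset.filter_subset_filter _ (Finset.filter_subset _ _)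

theorem card_le_card_deepPoints_add {R B : Finset ℂ} (hgp : ∀ σ ≠ 0, NondegOrient σ R B)
    (hd : Disjoint R B) {r : ℂ} (hr : r ∈ R) (k : ℕ) :
    B.card ≤ (deepPoints B r k).card + 4 * k := by
  classical
  have h1 := card_filter_few_left_le (hgp 1 one_ne_zero) hd hr k
  have h2 := card_filter_few_left_le (hgp (-1) (neg_ne_zero.2 one_ne_zero)) hd hr k
  have h3 : B ⊆ deepPoints B r k ∪
      ((B.filter fun b => (B.filter fun p => 0 < orient 1 r b p).card < k) ∪
      (B.filter fun b => (B.filter fun p => 0 < orient (-1) r b p).card < k)) := by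
    intro b hb
    simp only [deepPoints, Finset.mem_union, Finset.mem_filter, hb, true_and]
    omega
  have h4 := (Finset.card_le_card h3).trans (Finset.card_union_le _ _)
  have h5 := h4.trans (Nat.add_le_add_left (Finset.card_union_le _ _) _)
  omega

theorem card_filter_left_add_card_filter_right {R B S : Finset ℂ}
    (hgp : NondegOrient 1 R B) {x y : ℂ} (hx : x ∈ R ∨ x ∈ B) (hy : y ∈ R ∨ y ∈ B)
    (hxy : x ≠ y) (hS : ∀ p ∈ S, p ∈ R ∨ p ∈ B) (h : (x ∈ S ∧ y ∉ S) ∨ (y ∈ S ∧ x ∉ S)) :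
    (S.filter fun p => 0 < orient 1 x y p).card + (S.filter fun p => 0 < orient (-1) x y p).card
      + 1 = S.card := by
  classical
  obtain ⟨z, hz, hzS⟩ : ∃ z ∈ S, ∀ p ∈ S, p = z ↔ orient 1 x y p = 0 := by
    rcases h with ⟨h1, h2⟩ | ⟨h1, h2⟩
    · refine ⟨x, h1, fun p hp => ⟨by rintro rfl; simp, fun h => ?_⟩⟩
      by_contra hne
      exact hgp x y p hx hy (hS p hp) hxy (Ne.symm hne) (by rintro rfl; exact h2 hp) h
    · refine ⟨y, h1, fun p hp => ⟨by rintro rfl; simp, fun h => ?_⟩⟩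
      by_contra hne
      exact hgp x y p hx hy (hS p hp) hxy (by rintro rfl; exact h2 hp) (Ne.symm hne) h
  rw [← Finset.card_erase_add_one hz, ← Finset.card_union_of_disjoint]
  · congr 2
    ext p
    simp only [Finset.mem_union, Finset.mem_filter, Finset.mem_erase, orient_neg, neg_pos,
      ← and_or_left, and_comm (a := p ≠ z)]
    refine and_congr_right fun hp => ?_
    rw [Ne, hzS p hp, ← Ne, ← lt_or_lt_iff_ne, or_comm]
  · rw [Finset.disjoint_filter]
    intro p _ h1
    rw [orient_neg]
    linarith

/-- The dichotomy behind the lower bound, at a red point `r`. -/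
theorem card_deepPoints_le_or {R B : Finset ℂ} (hgp : ∀ σ ≠ 0, NondegOrient σ R B)
    (hd : Disjoint R B) (hcard : R.card = B.card) {r : ℂ} (hr : r ∈ R) {k m : ℕ} (hkm : m < k)
    {T : ℕ} (hT : ∀ σ ≠ 0, (emptyTriples σ R B).card ≤ T) :
    (k - (m + 1)) * (m + 1) ≤ T ∨ (deepPoints B r k).card ≤
      ((goodNeighbors 1 R B r).card + (goodNeighbors (-1) R B r).card) * (m + 2) := by
  classical
  rw [or_iff_not_imp_left]
  intro hT'
  have hm1 : (-1 : ℝ) ≠ 0 := neg_ne_zero.2 one_ne_zero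
  let N : ℝ → ℂ → Finset ℂ := fun σ b => B.filter fun b₀ => b₀ = b ∨ (0 < orient σ r b₀ b ∧
      (B.filter fun p => 0 < orient σ r b₀ p ∧ 0 < orient σ r p b).card ≤ m)
  have hN : ∀ σ ≠ 0, ((goodNeighbors σ R B r).biUnion (N σ)).card ≤
      (goodNeighbors σ R B r).card * (m + 2) := fun σ hσ =>
    Finset.card_biUnion_le_card_mul _ _ _ fun b _ => card_filter_orient_le_card (hgp σ hσ) hd hr
  have hside : ∀ σ ≠ 0, ∀ b₀ ∈ B, k ≤ (B.filter fun p => 0 < orient σ r b₀ p).card →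
      (B.filter fun p => 0 < orient σ r b₀ p).card ≤
        (R.filter fun p => 0 < orient σ r b₀ p).card →
      b₀ ∈ (goodNeighbors σ R B r).biUnion (N σ) := by
    intro σ hσ b₀ hb₀ hk hle
    rcases exists_goodNeighbor_or_le_card (hgp σ hσ) hd hr hb₀ (hkm.trans_le hk) hle
      with h | ⟨b, hb, h⟩
    · refine absurd (le_trans ?_ (h.trans (hT σ hσ))) hT'
      gcongr
    · exact Finset.mem_biUnion.2 ⟨b, hb, Finset.mem_filter.2 ⟨hb₀, h⟩⟩
  have hsub : deepPoints B r k ⊆ (goodNeighbors 1 R B r).biUnion (N 1) ∪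
      (goodNeighbors (-1) R B r).biUnion (N (-1)) := by
    intro b₀ hb
    obtain ⟨hb₀, hk1, hk2⟩ := Finset.mem_filter.1 hb
    have hne := Finset.disjoint_iff_ne.1 hd r hr b₀ hb₀
    have hb₀R := Finset.disjoint_right.1 hd hb₀
    have hrB := Finset.disjoint_left.1 hd hr
    have e1 := card_filter_left_add_card_filter_right (hgp 1 one_ne_zero) (S := B)
      (.inl hr) (.inr hb₀) hne (fun p hp => .inr hp) (.inr ⟨hb₀, hrB⟩)
    have e2 := card_filter_left_add_card_filter_right (hgp 1 one_ne_zero) (S := R)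
      (.inl hr) (.inr hb₀) hne (fun p hp => .inl hp) (.inl ⟨hr, hb₀R⟩)
    rcases le_total (B.filter fun p => 0 < orient 1 r b₀ p).card
      (R.filter fun p => 0 < orient 1 r b₀ p).card with h | h
    · exact Finset.mem_union_left _ (hside 1 one_ne_zero b₀ hb₀ hk1 h)
    · exact Finset.mem_union_right _ (hside (-1) hm1 b₀ hb₀ hk2 (by omega))
  calc _ ≤ _ := Finset.card_le_card hsub
    _ ≤ _ := Finset.card_union_le _ _
    _ ≤ _ := Nat.add_le_add (hN 1 one_ne_zero) (hN (-1) hm1)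
    _ = _ := (add_mul _ _ _).symm

theorem le_or_le_of_card_emptyTriples_le {R B : Finset ℂ} (hgp : ∀ σ ≠ 0, NondegOrient σ R B)
    (hd : Disjoint R B) {n : ℕ} (hR : R.card = n) (hB : B.card = n) {k m : ℕ} (hkm : m < k)
    {T : ℕ} (hT : ∀ σ ≠ 0, (emptyTriples σ R B).card ≤ T) :
    (k - (m + 1)) * (m + 1) ≤ T ∨ n * n ≤ 2 * T * (m + 2) + n * (4 * k) := by
  rw [or_iff_not_imp_left]
  intro hT'
  have h1 : ∀ r ∈ R, n ≤ ((goodNeighbors 1 R B r).card + (goodNeighbors (-1) R B r).card) *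
      (m + 2) + 4 * k := by
    intro r hr
    have h2 := card_le_card_deepPoints_add hgp hd hr k
    have h3 := (card_deepPoints_le_or hgp hd (hR.trans hB.symm) hr hkm hT).resolve_left hT'
    omega
  have h2 := Finset.sum_le_sum h1
  rw [Finset.sum_add_distrib, ← Finset.sum_mul, Finset.sum_add_distrib, Finset.sum_const,
    Finset.sum_const, hR, smul_eq_mul, smul_eq_mul] at h2
  refine h2.trans ?_
  have h3 := (sum_card_goodNeighbors_le 1 R B).trans (hT 1 one_ne_zero)
  have h4 := (sum_card_goodNeighbors_le (-1) R B).trans (hT (-1) (neg_ne_zero.2 one_ne_zero))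
  gcongr
  omega

/-- The arithmetic that turns the dichotomy into the bound `n ^ (3 / 2) / 5832`. -/
theorem rpow_three_halves_le {n T : ℕ} (hn : 1 ≤ n) (hT : 1 ≤ T)
    (h : ∀ k m : ℕ, m < k →
      (k - (m + 1)) * (m + 1) ≤ T ∨ n * n ≤ 2 * T * (m + 2) + n * (4 * k)) :
    (1 / 5832 : ℝ) * (n : ℝ) ^ ((3 : ℝ) / 2) ≤ T := by
  set x : ℝ := √n with hx
  have hx0 : 0 ≤ x := Real.sqrt_nonneg _
  have hxn : x ^ 2 = n := Real.sq_sqrt (by positivity)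
  have hT' : (1 : ℝ) ≤ T := by exact_mod_cast hT
  have hpow : (n : ℝ) ^ ((3 : ℝ) / 2) = x ^ 3 := by
    rw [← hxn, ← Real.rpow_natCast x 2, ← Real.rpow_mul hx0, ← Real.rpow_natCast x 3]
    norm_num
  rw [hpow]
  rcases le_total x 18 with h18 | h18
  · have : x ^ 3 ≤ 18 ^ 3 := by gcongr
    linarith
  have hm1 : ((Nat.sqrt n : ℕ) : ℝ) ≤ x := Real.nat_sqrt_le_real_sqrt
  have hm2 : x ≤ (Nat.sqrt n : ℕ) + 1 := Real.real_sqrt_le_nat_sqrt_succ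
  have hk1 : ((n / 8 : ℕ) : ℝ) * 8 ≤ n := by exact_mod_cast Nat.div_mul_le_self n 8
  have hk2 : (n : ℝ) ≤ ((n / 8 : ℕ) : ℝ) * 8 + 8 := by
    have : n ≤ n / 8 * 8 + 8 := by omega
    exact_mod_cast this
  generalize hk : n / 8 = k at *
  generalize hm : Nat.sqrt n = m at *
  have hlt : (m : ℝ) + 1 < k := by nlinarith
  have hlt' : m + 1 < k := by exact_mod_cast hlt
  rcases h k m (by omega) with h1 | h1
  · have h2 : ((k : ℝ) - (m + 1)) * (m + 1) ≤ T := by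
      have : (((k - (m + 1)) * (m + 1) : ℕ) : ℝ) ≤ T := by exact_mod_cast h1
      rwa [Nat.cast_mul, Nat.cast_sub hlt'.le, Nat.cast_add, Nat.cast_one] at this
    have h3 : x ^ 2 / 16 ≤ (k : ℝ) - (m + 1) := by nlinarith
    calc 1 / 5832 * x ^ 3 ≤ x ^ 2 / 16 * x := by
          have : 0 ≤ x ^ 3 := by positivity
          linarith
      _ ≤ ((k : ℝ) - (m + 1)) * (m + 1) := by gcongr
      _ ≤ T := h2
  · have h2 : (n : ℝ) * n ≤ 2 * T * (m + 2) + n * (4 * k) := by exact_mod_cast h1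
    have h3 : (n : ℝ) * (4 * k) ≤ n * (n / 2) := by gcongr; linarith
    have h4 : 2 * (T : ℝ) * (m + 2) ≤ 2 * T * (2 * x) := by gcongr; linarith
    rw [← hxn] at h2 h3
    have h5 : x * x ^ 3 ≤ x * (8 * T) := by nlinarith
    have h6 := le_of_mul_le_mul_left h5 (by linarith)
    linarith [pow_nonneg hx0 3]

theorem GenPos.nondegOrient {R B : Finset ℂ} (h : GenPos (↑R ∪ ↑B : Set ℂ)) {σ : ℝ}
    (hσ : σ ≠ 0) : NondegOrient σ R B := fun x y z hx hy hz hxy hxz hyz =>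
  orient_ne_zero_of_not_collinear hσ hxy
    (h x (by simpa using hx) y (by simpa using hy) z (by simpa using hz) hxy hxz hyz)

/-- There is an absolute constant `c > 0` such that: for every `2n`-point set `P` in
general position and every partition `P = R ∪ B` with `|R| = |B| = n ≥ 2`, the number of
empty triangles with exactly two red vertices and one blue vertex is at least `c·n^{3/2}`. -/
theorem stmt_12 :
    ∃ c : ℝ, 0 < c ∧ ∀ (P R B : Finset ℂ) (n : ℕ),
      2 ≤ n → R.card = n → B.card = n → Disjoint R B → R ∪ B = P →
      GenPos (↑P : Set ℂ) →
      c * (n : ℝ) ^ ((3 : ℝ) / 2) ≤ ((emptyRRB R B).ncard : ℝ) := by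
  refine ⟨1 / 5832, by norm_num, ?_⟩
  rintro P R B n hn hR hB hd rfl hP
  rw [Finset.coe_union] at hP
  have hgp : ∀ σ ≠ 0, NondegOrient σ R B := fun σ hσ => hP.nondegOrient hσ
  have hT : ∀ σ ≠ 0, (emptyTriples σ R B).card ≤ (emptyRRB R B).ncard := fun σ hσ =>
    card_emptyTriples_le (hgp σ hσ) hd
  refine rpow_three_halves_le (by omega) ?_ fun k m hkm =>
    le_or_le_of_card_emptyTriples_le hgp hd hR hB hkm hT
  obtain ⟨r, hr, s, hs, hrs⟩ := Finset.one_lt_card.1 (by omega : 1 < R.card)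
  obtain ⟨b, hb⟩ := Finset.card_pos.1 (by omega : 0 < B.card)
  have h0 := hgp 1 one_ne_zero r b s (.inl hr) (.inr hb) (.inl hs)
    (Finset.disjoint_iff_ne.1 hd r hr b hb) hrs (Finset.disjoint_iff_ne.1 hd s hs b hb).symm
  obtain ⟨σ, hσ, hpos⟩ : ∃ σ : ℝ, σ ≠ 0 ∧ 0 < orient σ r b s := by
    rcases h0.lt_or_gt with h | h
    · exact ⟨-1, by norm_num, by rw [orient_neg]; linarith⟩
    · exact ⟨1, one_ne_zero, h⟩
  exact (Finset.card_pos.2 (emptyTriples_nonempty hr hb hs hpos)).trans_le (hT σ hσ)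
end
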